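/- arXiv:math/0502458 — 2 statements merged into one kernel-verified Lean document; each statement's English description precedes it below -/
import Mathlib

section
/- Let T be the Liverani–Saussol–Vaienti intermittent map with parameter α∈(0,1). If f:[0,1]→ℝ is Hölder continuous on [0,1/2] and on (1/2,1] and f(0)≠0, then f is not a measurable coboundary: there is no measurable u:[0,1]→ℝ with f = u - u∘T Lebesgue almost everywhere. -/
open MeasureTheory Set

/-- The Liverani–Saussol–Vaienti intermittent map with parameter `a ∈ (0,1)`:
`T x = x (1 + 2^a x^a)` for `x ≤ 1/2` and `T x = 2x - 1` for `x > 1/2`. -/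
noncomputable def lsv (a : ℝ) (x : ℝ) : ℝ :=
  if x ≤ 1/2 then x * (1 + (2:ℝ) ^ a * x ^ a) else 2 * x - 1

/-- derivative of the map -/
noncomputable def lsvD (a : ℝ) (x : ℝ) : ℝ :=
  if x ≤ 1/2 then 1 + (1 + a) * ((2:ℝ) ^ a * x ^ a) else 2

lemma lsv_left {a x : ℝ} (hx : x ≤ 1/2) : lsv a x = x * (1 + (2:ℝ) ^ a * x ^ a) := if_pos hx
lemma lsv_right {a x : ℝ} (hx : ¬ x ≤ 1/2) : lsv a x = 2 * x - 1 := if_neg hx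

lemma s_pos {a x : ℝ} (hx : 0 < x) : 0 < (2:ℝ) ^ a * x ^ a := by positivity

lemma s_le {a x : ℝ} (ha : 0 < a) (hx : 0 < x) (hx2 : x ≤ 1/2) : (2:ℝ) ^ a * x ^ a ≤ 1 := by
  rw [← Real.mul_rpow (by norm_num) hx.le]
  exact Real.rpow_le_one (by positivity) (by linarith) ha.le

lemma s_mono {a x y : ℝ} (ha : 0 < a) (hx : 0 < x) (hxy : x ≤ y) :
    (2:ℝ) ^ a * x ^ a ≤ (2:ℝ) ^ a * y ^ a := by
  gcongr

lemma lsv_mem {a x : ℝ} (ha : 0 < a) (hx : x ∈ Ioc (0:ℝ) 1) : lsv a x ∈ Ioc (0:ℝ) 1 := by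
  obtain ⟨h0, h1⟩ := hx
  by_cases h : x ≤ 1/2
  · rw [lsv_left h]
    have := s_pos (a := a) h0
    have := s_le ha h0 h
    constructor
    · positivity
    · nlinarith
  · rw [lsv_right h]
    push Not at h
    constructor <;> linarith

lemma iter_mem {a x : ℝ} (ha : 0 < a) (hx : x ∈ Ioc (0:ℝ) 1) (n : ℕ) :
    (lsv a)^[n] x ∈ Ioc (0:ℝ) 1 := by
  induction n with
  | zero => simpa using hx
  | succ n ih => rw [Function.iterate_succ_apply']; exact lsv_mem ha ih

/-- tangent line inequality for the convex power -/
lemma conv_tangent {a p q : ℝ} (ha : 0 < a) (hp : 0 < p) (hq : 0 < q) :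
    p * p ^ a + (1 + a) * p ^ a * (q - p) ≤ q * q ^ a := by
  have h := one_add_mul_self_le_rpow_one_add (s := q / p - 1)
    (by have : 0 < q / p := by positivity
        linarith) (p := 1 + a) (by linarith)
  have e : 1 + (q / p - 1) = q / p := by ring
  rw [e, Real.div_rpow hq.le hp.le, Real.rpow_add hq, Real.rpow_add hp, Real.rpow_one,
    Real.rpow_one, le_div_iff₀ (by positivity)] at h
  have e2 : (1 + (1 + a) * (q / p - 1)) * (p * p ^ a)
      = p * p ^ a + (1 + a) * p ^ a * (q - p) := by
    field_simp
  linarith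

lemma conc_tangent {a p q : ℝ} (ha : 0 < a) (ha1 : a < 1) (hp : 0 < p) (hq : 0 < q) :
    q ^ a ≤ p ^ a + a * p ^ a * ((q - p) / p) := by
  have h := rpow_one_add_le_one_add_mul_self (s := q / p - 1)
    (by have : 0 < q / p := by positivity
        linarith) (p := a) ha.le ha1.le
  have e : 1 + (q / p - 1) = q / p := by ring
  rw [e, Real.div_rpow hq.le hp.le, div_le_iff₀ (by positivity)] at h
  have e2 : (1 + a * (q / p - 1)) * (p ^ a) = p ^ a + a * p ^ a * ((q - p) / p) := by
    field_simp
  linarith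

/-- one-step lower bound -/
lemma step_lower {a p q : ℝ} (ha : 0 < a) (hp : 0 < p) (hpq : p ≤ q)
    (hs : p ≤ 1/2 ↔ q ≤ 1/2) : lsvD a p * (q - p) ≤ lsv a q - lsv a p := by
  by_cases h : p ≤ 1/2
  · rw [lsv_left h, lsv_left (hs.1 h), lsvD, if_pos h]
    have h1 := conv_tangent ha hp (lt_of_lt_of_le hp hpq)
    have h2 : (0:ℝ) < 2 ^ a := by positivity
    nlinarith [mul_le_mul_of_nonneg_left h1 h2.le]
  · rw [lsv_right h, lsv_right (fun h' => h (hs.2 h')), lsvD, if_neg h]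
    linarith

lemma step_upper {a p q : ℝ} (ha : 0 < a) (hp : 0 < p) (hpq : p ≤ q)
    (hs : p ≤ 1/2 ↔ q ≤ 1/2) : lsv a q - lsv a p ≤ lsvD a q * (q - p) := by
  by_cases h : p ≤ 1/2
  · rw [lsv_left h, lsv_left (hs.1 h), lsvD, if_pos (hs.1 h)]
    have h1 := conv_tangent ha (lt_of_lt_of_le hp hpq) hp
    have h2 : (0:ℝ) < 2 ^ a := by positivity
    nlinarith [mul_le_mul_of_nonneg_left h1 h2.le]
  · rw [lsv_right h, lsv_right (fun h' => h (hs.2 h')), lsvD, if_neg (fun h' => h (hs.2 h'))]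
    linarith

lemma lsvD_ge_one {a p : ℝ} (ha : 0 < a) (hp : 0 < p) : 1 ≤ lsvD a p := by
  unfold lsvD
  have := s_pos (a := a) hp
  split_ifs
  · nlinarith
  · norm_num

lemma lsvD_mono {a p q : ℝ} (ha : 0 < a) (hp : 0 < p) (hpq : p ≤ q)
    (hs : p ≤ 1/2 ↔ q ≤ 1/2) : lsvD a p ≤ lsvD a q := by
  by_cases h : p ≤ 1/2
  · rw [lsvD, lsvD, if_pos h, if_pos (hs.1 h)]
    have := s_mono ha hp hpq
    gcongr
  · rw [lsvD, lsvD, if_neg h, if_neg (fun h' => h (hs.2 h'))]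

lemma step_mono {a p q : ℝ} (ha : 0 < a) (hp : 0 < p) (hpq : p ≤ q)
    (hs : p ≤ 1/2 ↔ q ≤ 1/2) : q - p ≤ lsv a q - lsv a p := by
  have h1 := step_lower ha hp hpq hs
  have h2 := lsvD_ge_one ha hp
  nlinarith

/-- expansion when the larger point is above `t`. -/
lemma step_expand {a p q t : ℝ} (ha : 0 < a) (hp : 0 < p) (hpq : p ≤ q) (ht : 0 < t)
    (ht2 : t ≤ 1/2) (htq : t ≤ q)
    (hs : p ≤ 1/2 ↔ q ≤ 1/2) :
    (1 + (2:ℝ) ^ a * t ^ a) * (q - p) ≤ lsv a q - lsv a p := by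
  by_cases h : p ≤ 1/2
  · rw [lsv_left h, lsv_left (hs.1 h)]
    have h1 := s_mono ha ht htq
    have h2 := s_mono ha hp hpq
    have : (2:ℝ) ^ a * t ^ a * (q - p) ≤ (2:ℝ) ^ a * q ^ a * (q - p) :=
      mul_le_mul_of_nonneg_right h1 (by linarith)
    nlinarith [mul_le_mul_of_nonneg_left h2 hp.le]
  · rw [lsv_right h, lsv_right (fun h' => h (hs.2 h'))]
    have := s_le ha ht ht2
    nlinarith

/-- potential function estimate for distortion -/
lemma step_dist {a p q : ℝ} (ha : 0 < a) (ha1 : a < 1) (hp : 0 < p) (hpq : p ≤ q) (hq1 : q ≤ 1)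
    (hs : p ≤ 1/2 ↔ q ≤ 1/2) :
    lsvD a q ≤ lsvD a p *
      Real.exp (4 * ((lsv a q - lsv a p) / lsv a p - (q - p) / p)) := by
  have hTp := (lsv_mem ha (x := p) ⟨hp, hpq.trans hq1⟩).1
  have hlow := step_lower ha hp hpq hs
  by_cases h : p ≤ 1/2
  · set s := (2:ℝ) ^ a * p ^ a with hsdef
    set r := (q - p) / p with hr
    set r' := (lsv a q - lsv a p) / lsv a p with hr'
    have hs0 : 0 < s := s_pos hp
    have hs1 : s ≤ 1 := s_le ha hp h
    have hr0 : 0 ≤ r := div_nonneg (by linarith) hp.le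
    have hqp : q - p = r * p := by rw [hr]; field_simp
    have hT : lsv a p = p * (1 + s) := lsv_left h
    have hD : lsvD a p = 1 + (1 + a) * s := if_pos h
    have hD' : lsvD a q = 1 + (1 + a) * ((2:ℝ) ^ a * q ^ a) := if_pos (hs.1 h)
    have key : r + a / 2 * s * r ≤ r' := by
      rw [hr', le_div_iff₀ hTp]
      rw [hD] at hlow
      refine le_trans ?_ hlow
      rw [hT, hqp]
      have : 0 ≤ p * r * (a / 2 * s * (1 - s)) := by
        have : 0 ≤ 1 - s := by linarith
        positivity
      nlinarith
    have hc := conc_tangent ha ha1 hp (lt_of_lt_of_le hp hpq)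
    have h2 : (0:ℝ) < 2 ^ a := by positivity
    have hc2 : (2:ℝ) ^ a * q ^ a ≤ s + a * s * r := by
      have := mul_le_mul_of_nonneg_left hc h2.le
      rw [← hr] at this
      rw [hsdef]; linarith
    have e1 : 1 + 4 * (r' - r) ≤ Real.exp (4 * (r' - r)) := by
      have := Real.add_one_le_exp (4 * (r' - r)); linarith
    have hDp : 1 ≤ lsvD a p := lsvD_ge_one ha hp
    have hasr : 0 ≤ a * s * r := by positivity
    have hrr : 0 ≤ r' - r := by nlinarith
    calc lsvD a q ≤ lsvD a p + (1 + a) * (a * s * r) := by rw [hD', hD]; nlinarith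
      _ ≤ lsvD a p + 4 * (r' - r) := by nlinarith
      _ ≤ lsvD a p * (1 + 4 * (r' - r)) := by nlinarith
      _ ≤ _ := by gcongr
  · have hq : ¬ q ≤ 1/2 := fun h' => h (hs.2 h')
    have hle : (q - p) / p ≤ (lsv a q - lsv a p) / lsv a p := by
      rw [div_le_div_iff₀ hp hTp, lsv_right h, lsv_right hq]
      nlinarith
    have : 1 ≤ Real.exp (4 * ((lsv a q - lsv a p) / lsv a p - (q - p) / p)) :=
      Real.one_le_exp (by linarith)
    rw [lsvD, lsvD, if_neg h, if_neg hq]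
    linarith

/-- same cylinder of length `N` -/
def Same (a : ℝ) (N : ℕ) (x y : ℝ) : Prop :=
  ∀ k < N, ((lsv a)^[k] x ≤ 1/2 ↔ (lsv a)^[k] y ≤ 1/2)

lemma Same.symm {a : ℝ} {N : ℕ} {x y : ℝ} (h : Same a N x y) : Same a N y x :=
  fun k hk => (h k hk).symm
lemma Same.trans {a : ℝ} {N : ℕ} {x y z : ℝ} (h : Same a N x y) (h' : Same a N y z) :
    Same a N x z := fun k hk => (h k hk).trans (h' k hk)
lemma Same.pred {a : ℝ} {N : ℕ} {x y : ℝ} (h : Same a (N+1) x y) : Same a N x y :=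
  fun k hk => h k (by omega)

lemma same_mono {a : ℝ} (ha : 0 < a) {N : ℕ} {x y : ℝ} (hx : x ∈ Ioc (0:ℝ) 1)
    (h : Same a N x y) (hxy : x ≤ y) :
    y - x ≤ (lsv a)^[N] y - (lsv a)^[N] x := by
  induction N with
  | zero => simp
  | succ n ih =>
    have := ih h.pred
    rw [Function.iterate_succ_apply', Function.iterate_succ_apply']
    have h2 := step_mono ha (iter_mem ha hx n).1 (by linarith) (h n (by omega))
    linarith

lemma same_le_iff {a : ℝ} (ha : 0 < a) {N : ℕ} {x y : ℝ} (hx : x ∈ Ioc (0:ℝ) 1)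
    (hy : y ∈ Ioc (0:ℝ) 1)
    (h : Same a N x y) : x ≤ y ↔ (lsv a)^[N] x ≤ (lsv a)^[N] y := by
  constructor
  · intro hxy
    have := same_mono ha hx h hxy
    linarith
  · intro hT
    by_contra! hlt
    have := same_mono ha hy h.symm hlt.le
    linarith

/-- product of derivatives -/
noncomputable def DN (a : ℝ) (N : ℕ) (x : ℝ) : ℝ := ∏ k ∈ Finset.range N, lsvD a ((lsv a)^[k] x)

lemma DN_pos {a : ℝ} (ha : 0 < a) (N : ℕ) {x : ℝ} (hx : x ∈ Ioc (0:ℝ) 1) : 0 < DN a N x :=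
  Finset.prod_pos fun k _ => lt_of_lt_of_le one_pos (lsvD_ge_one ha (iter_mem ha hx k).1)

lemma DN_bounds {a : ℝ} (ha : 0 < a) (ha1 : a < 1) {N : ℕ} {x y : ℝ} (hx : x ∈ Ioc (0:ℝ) 1)
    (hy : y ∈ Ioc (0:ℝ) 1)
    (h : Same a N x y) (hxy : x ≤ y) :
    DN a N x * (y - x) ≤ (lsv a)^[N] y - (lsv a)^[N] x ∧
    (lsv a)^[N] y - (lsv a)^[N] x ≤ DN a N y * (y - x) ∧
    DN a N x ≤ DN a N y ∧
    DN a N y ≤ DN a N x * Real.exp (4 * (((lsv a)^[N] y - (lsv a)^[N] x) / (lsv a)^[N] x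
      - (y - x) / x)) := by
  induction N with
  | zero => simp [DN]
  | succ n ih =>
    obtain ⟨h1, h2, h3, h4⟩ := ih h.pred
    have hm := same_mono ha hx h.pred hxy
    have e : ∀ z, DN a (n+1) z = DN a n z * lsvD a ((lsv a)^[n] z) := fun z =>
      Finset.prod_range_succ _ _
    rw [Function.iterate_succ_apply', Function.iterate_succ_apply', e, e]
    set p := (lsv a)^[n] x
    set q := (lsv a)^[n] y
    have hp : p ∈ Ioc (0:ℝ) 1 := iter_mem ha hx n
    have hq : q ∈ Ioc (0:ℝ) 1 := iter_mem ha hy n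
    have hpq : p ≤ q := by linarith
    have hs : p ≤ 1/2 ↔ q ≤ 1/2 := h n (by omega)
    have g1 := step_lower ha hp.1 hpq hs
    have g2 := step_upper ha hp.1 hpq hs
    have g3 := lsvD_mono ha hp.1 hpq hs
    have g4 := step_dist ha ha1 hp.1 hpq hq.2 hs
    have dp : 0 < lsvD a p := lt_of_lt_of_le one_pos (lsvD_ge_one ha hp.1)
    have dq : 0 < lsvD a q := lt_of_lt_of_le one_pos (lsvD_ge_one ha hq.1)
    have Dx := DN_pos ha n hx
    have Dy := DN_pos ha n hy
    refine ⟨?_, ?_, by gcongr, ?_⟩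
    · nlinarith [mul_le_mul_of_nonneg_left h1 dp.le]
    · nlinarith [mul_le_mul_of_nonneg_left h2 dq.le]
    · refine (mul_le_mul h4 g4 dq.le (by positivity)).trans (le_of_eq ?_)
      rw [mul_mul_mul_comm, ← Real.exp_add]
      congr 2
      ring

lemma left_surj {a : ℝ} (ha : 0 < a) {w : ℝ} (hw : w ∈ Ioc (0:ℝ) 1) :
    ∃ y ∈ Ioc (0:ℝ) (1/2), lsv a y = w := by
  have hc : ContinuousOn (fun x : ℝ => x * (1 + (2:ℝ) ^ a * x ^ a)) (Icc 0 (1/2)) := by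
    have : Continuous (fun x : ℝ => x ^ a) := Real.continuous_rpow_const ha.le
    fun_prop
  have h := intermediate_value_Icc (by norm_num) hc
  have e1 : (1/2:ℝ) * (1 + (2:ℝ) ^ a * (1/2) ^ a) = 1 := by
    rw [← Real.mul_rpow (by norm_num) (by norm_num)]; norm_num
  have : w ∈ Icc ((fun x : ℝ => x * (1 + (2:ℝ) ^ a * x ^ a)) 0)
      ((fun x : ℝ => x * (1 + (2:ℝ) ^ a * x ^ a)) (1/2)) := by
    simp only [e1, zero_mul]; exact ⟨hw.1.le, hw.2⟩
  obtain ⟨y, hy, hyw⟩ := h this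
  refine ⟨y, ⟨lt_of_le_of_ne hy.1 ?_, hy.2⟩, by rw [lsv_left hy.2]; exact hyw⟩
  rintro rfl
  simp at hyw
  linarith [hw.1]

lemma same_surj {a : ℝ} (ha : 0 < a) (N : ℕ) {w : ℝ} (hw : w ∈ Ioc (0:ℝ) 1) :
    ∀ x ∈ Ioc (0:ℝ) 1, ∃ y ∈ Ioc (0:ℝ) 1, Same a N x y ∧ (lsv a)^[N] y = w := by
  induction N with
  | zero => intro x _; exact ⟨w, hw, fun k hk => by omega, rfl⟩
  | succ n ih =>
    intro x hx
    obtain ⟨y', hy', hS, hT⟩ := ih (lsv a x) (lsv_mem ha hx)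
    have : ∃ y ∈ Ioc (0:ℝ) 1, (x ≤ 1/2 ↔ y ≤ 1/2) ∧ lsv a y = y' := by
      by_cases h : x ≤ 1/2
      · obtain ⟨y, hy, e⟩ := left_surj ha hy'
        exact ⟨y, ⟨hy.1, by linarith [hy.2]⟩, iff_of_true h hy.2, e⟩
      · have h2 : ¬ ((1 + y') / 2 ≤ 1/2) := by have := hy'.1; intro; linarith
        refine ⟨(1 + y')/2, ⟨by linarith [hy'.1], by linarith [hy'.2]⟩, iff_of_false h h2, ?_⟩
        rw [lsv_right h2]; ring
    obtain ⟨y, hy, hs, e⟩ := this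
    refine ⟨y, hy, ?_, by rw [Function.iterate_succ_apply, e, hT]⟩
    intro k hk
    cases k with
    | zero => simpa using hs
    | succ k =>
      rw [Function.iterate_succ_apply, Function.iterate_succ_apply, e]
      exact hS k (by omega)


lemma vol_image_le {K : NNReal} {f : ℝ → ℝ} {s : Set ℝ} (h : LipschitzOnWith K f s) :
    volume (f '' s) ≤ K * volume s := by
  have := h.hausdorffMeasure_image_le (d := 1) zero_le_one
  rw [hausdorffMeasure_real, ENNReal.rpow_one] at this
  exact this

lemma vol_le_image {f : ℝ → ℝ} {s : Set ℝ} (h : ∀ x ∈ s, ∀ y ∈ s, |x - y| ≤ |f x - f y|) :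
    volume s ≤ volume (f '' s) := by
  have hinj : InjOn f s := by
    intro x hx y hy hxy
    have := h x hx y hy
    rw [hxy, sub_self, abs_zero] at this
    linarith [abs_nonpos_iff.1 this]
  have hL : LipschitzOnWith 1 (Function.invFunOn f s) (f '' s) := by
    refine LipschitzOnWith.of_dist_le_mul ?_
    rintro _ ⟨x, hx, rfl⟩ _ ⟨y, hy, rfl⟩
    rw [hinj.leftInvOn_invFunOn hx, hinj.leftInvOn_invFunOn hy]
    simpa [Real.dist_eq] using h x hx y hy
  have := vol_image_le hL
  rw [hinj.leftInvOn_invFunOn.image_image] at this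
  simpa using this

lemma same_abs {a : ℝ} (ha : 0 < a) {N : ℕ} {x y : ℝ} (hx : x ∈ Ioc (0:ℝ) 1)
    (hy : y ∈ Ioc (0:ℝ) 1)
    (h : Same a N x y) : |x - y| ≤ |(lsv a)^[N] x - (lsv a)^[N] y| := by
  rcases le_total x y with hxy | hxy
  · have := same_mono ha hx h hxy
    rw [abs_of_nonpos (by linarith), abs_of_nonpos (by linarith)]; linarith
  · have := same_mono ha hy h.symm hxy
    rw [abs_of_nonneg (by linarith), abs_of_nonneg (by linarith)]; linarith

lemma ae_comp {a : ℝ} (ha : 0 < a) {P : ℝ → Prop}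
    (hP : ∀ᵐ x ∂(volume.restrict (Ioc (0:ℝ) 1)), P x) :
    ∀ᵐ x ∂(volume.restrict (Ioc (0:ℝ) 1)), P (lsv a x) := by
  rw [ae_restrict_iff' measurableSet_Ioc, ae_iff] at hP ⊢
  set Z := {x | ¬ (x ∈ Ioc (0:ℝ) 1 → P x)} with hZ
  have key : ∀ b : Prop, volume {x | x ∈ Ioc (0:ℝ) 1 ∧ (x ≤ 1/2 ↔ b) ∧ ¬ P (lsv a x)} = 0 := by
    intro b
    have h1 := vol_le_image (f := lsv a)
      (s := {x | x ∈ Ioc (0:ℝ) 1 ∧ (x ≤ 1/2 ↔ b) ∧ ¬ P (lsv a x)}) (by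
        rintro x ⟨hx, hxb, _⟩ y ⟨hy, hyb, _⟩
        have : Same a 1 x y := by
          intro k hk
          have : k = 0 := by omega
          subst this
          simpa using hxb.trans hyb.symm
        exact same_abs ha hx hy this)
    refine le_antisymm (h1.trans ((measure_mono ?_).trans hP.le)) (zero_le)
    rintro _ ⟨x, ⟨hx, _, hxP⟩, rfl⟩
    simp only [hZ, mem_ofPred_eq, Classical.not_imp]
    exact ⟨lsv_mem ha hx, hxP⟩
  refine measure_mono_null ?_ (measure_union_null (key True) (key False))
  intro x hx
  simp only [mem_ofPred_eq, Classical.not_imp] at hx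
  by_cases h : x ≤ 1/2
  · left; exact ⟨hx.1, iff_of_true h trivial, hx.2⟩
  · right; exact ⟨hx.1, iff_of_false h id, hx.2⟩

lemma ae_iter {a : ℝ} (ha : 0 < a) {P : ℝ → Prop}
    (hP : ∀ᵐ x ∂(volume.restrict (Ioc (0:ℝ) 1)), P x) :
    ∀ᵐ x ∂(volume.restrict (Ioc (0:ℝ) 1)), ∀ k : ℕ, P ((lsv a)^[k] x) := by
  rw [ae_all_iff]
  intro k
  induction k with
  | zero => simpa using hP
  | succ n ih =>
    have := ae_comp ha ih
    simpa [Function.iterate_succ_apply] using this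

lemma lsv_measurable (a : ℝ) : Measurable (lsv a) := by
  unfold lsv
  refine Measurable.ite measurableSet_Iic ?_ ?_ <;> fun_prop

lemma iter_measurable (a : ℝ) (k : ℕ) : Measurable ((lsv a)^[k]) := (lsv_measurable a).iterate k

instance isProb_unit : IsProbabilityMeasure (volume.restrict (Ioc (0:ℝ) 1)) :=
  ⟨by simp⟩

/-- distribution function of `T^k` -/
noncomputable def GG (a : ℝ) (k : ℕ) (t : ℝ) : ℝ :=
  (volume.restrict (Ioc (0:ℝ) 1)).real {x | (lsv a)^[k] x ≤ t}

lemma GG_mono (a : ℝ) (k : ℕ) : Monotone (GG a k) := by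
  intro s t hst
  exact measureReal_mono (fun x hx => le_trans hx hst)

lemma GG_zero {a : ℝ} (ha : 0 < a) (k : ℕ) : GG a k 0 = 0 := by
  unfold GG
  rw [measureReal_eq_zero_iff, ← nonpos_iff_eq_zero, Measure.restrict_apply
    (measurableSet_le (iter_measurable a k) measurable_const)]
  refine (measure_mono (t := ∅) ?_).trans (by simp)
  rintro x ⟨h1, h2⟩
  have := (iter_mem ha h2 k).1
  simp only [mem_ofPred_eq] at h1
  linarith

lemma GG_le_one (a : ℝ) (k : ℕ) (t : ℝ) : GG a k t ≤ 1 := measureReal_le_one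

noncomputable def T0 (a x : ℝ) : ℝ := x * (1 + (2:ℝ) ^ a * x ^ a)

lemma T0_strictMono {a : ℝ} (ha : 0 < a) : StrictMonoOn (T0 a) (Ici 0) := by
  intro x hx y hy hxy
  unfold T0
  have hx' : (0:ℝ) ≤ x := hx
  have h : x ^ a ≤ y ^ a := Real.rpow_le_rpow hx' hxy.le ha.le
  have h2 : (0:ℝ) ≤ x ^ a := Real.rpow_nonneg hx' _
  have h3 : (0:ℝ) < 2 ^ a := by positivity
  have h4 : 1 + (2:ℝ) ^ a * x ^ a ≤ 1 + (2:ℝ) ^ a * y ^ a := by gcongr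
  have h5 : 1 ≤ 1 + (2:ℝ) ^ a * x ^ a := by nlinarith [mul_nonneg h3.le h2]
  nlinarith

lemma T0_convex {a : ℝ} (ha : 0 < a) : ConvexOn ℝ (Ici 0) (T0 a) := by
  have h1 := (convexOn_rpow (p := 1 + a) (by linarith)).smul (c := (2:ℝ) ^ a) (by positivity)
  have h2 := (convexOn_id (𝕜 := ℝ) (convex_Ici (0:ℝ))).add h1
  refine h2.congr ?_
  intro x hx
  have hx' : (0:ℝ) ≤ x := hx
  simp only [Pi.add_apply, id, T0, smul_eq_mul]
  rw [Real.rpow_one_add' hx' (by linarith)]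
  ring

lemma T0_surj {a : ℝ} (ha : 0 < a) {t : ℝ} (ht : t ∈ Icc (0:ℝ) 1) :
    ∃ s ∈ Icc (0:ℝ) (1/2), T0 a s = t := by
  rcases eq_or_lt_of_le ht.1 with h | h
  · exact ⟨0, by norm_num, by simp [T0, ← h]⟩
  · obtain ⟨s, hs, e⟩ := left_surj ha ⟨h, ht.2⟩
    exact ⟨s, ⟨hs.1.le, hs.2⟩, by rw [← e, lsv_left hs.2, T0]⟩

/-- key power inequality -/
lemma pow_gain {a s : ℝ} (ha : 0 < a) (ha1 : a < 1) (hs : 0 ≤ s) (hs2 : s ≤ 1/2) :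
    4 / (1 - a) * s ^ (1 - a) + T0 a s ≤ 4 / (1 - a) * (T0 a s) ^ (1 - a) := by
  rcases eq_or_lt_of_le hs with h | h
  · subst h
    simp [T0]
  have h1a : 0 < 1 - a := by linarith
  set v := (2:ℝ) ^ a * s ^ a with hv
  have hv0 : 0 < v := s_pos h
  have hv1 : v ≤ 1 := s_le ha h hs2
  have hT : T0 a s = s * (1 + v) := rfl
  rw [hT, Real.mul_rpow h.le (by linarith)]
  have hb : 1 + (1 - a) * v / 2 ≤ (1 + v) ^ (1 - a) := by
    rw [Real.rpow_sub (by linarith), Real.rpow_one, le_div_iff₀ (by positivity)]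
    have := rpow_one_add_le_one_add_mul_self (s := v) (by linarith) ha.le ha1.le
    refine (mul_le_mul_of_nonneg_left this (by positivity)).trans ?_
    have : 0 ≤ (1 - a) * v * (1 - a * v) := by
      have : a * v ≤ 1 := by nlinarith
      have : 0 ≤ 1 - a * v := by linarith
      positivity
    nlinarith
  have hsv : s ≤ s ^ (1 - a) * v := by
    have e : s ^ (1 - a) * v = 2 ^ a * s := by
      rw [hv, mul_left_comm, ← Real.rpow_add h]; simp
    rw [e]
    have : (1:ℝ) ≤ 2 ^ a := Real.one_le_rpow (by norm_num) ha.le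
    nlinarith
  have hp : 0 < s ^ (1 - a) := by positivity
  have : 4 / (1 - a) * (s ^ (1 - a) * (1 + (1 - a) * v / 2)) ≤
      4 / (1 - a) * (s ^ (1 - a) * (1 + v) ^ (1 - a)) := by gcongr
  refine le_trans ?_ this
  have e : 4 / (1 - a) * (s ^ (1 - a) * (1 + (1 - a) * v / 2)) =
    4 / (1 - a) * s ^ (1 - a) + 2 * (s ^ (1 - a) * v) := by field_simp; ring
  rw [e]
  nlinarith

lemma GG_succ {a : ℝ} (ha : 0 < a) (k : ℕ) {t s : ℝ} (ht : t ∈ Icc (0:ℝ) 1)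
    (hs : s ∈ Icc (0:ℝ) (1/2)) (hst : T0 a s = t) :
    GG a (k+1) t = GG a k s + (GG a k ((1 + t) / 2) - GG a k (1/2)) := by
  unfold GG
  set μ := volume.restrict (Ioc (0:ℝ) 1)
  have hm : ∀ r : ℝ, MeasurableSet {x | (lsv a)^[k] x ≤ r} := fun r =>
    measurableSet_le (iter_measurable a k) measurable_const
  rw [← measureReal_sdiff (by intro x hx; simp only [mem_ofPred_eq] at hx ⊢; linarith [ht.1]) (hm _),
    ← measureReal_union _ ((hm _).diff (hm _))]
  · refine measureReal_congr ?_
    have : ∀ᵐ x ∂μ, x ∈ Ioc (0:ℝ) 1 := ae_restrict_mem measurableSet_Ioc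
    filter_upwards [this] with x hx
    have hz := iter_mem ha hx k
    apply propext
    change (lsv a)^[k+1] x ≤ t ↔ ((lsv a)^[k] x ≤ s ∨ ((lsv a)^[k] x ≤ (1+t)/2 ∧ ¬ (lsv a)^[k] x ≤ 1/2))
    rw [Function.iterate_succ_apply']
    set z := (lsv a)^[k] x
    by_cases h : z ≤ 1/2
    · have : lsv a z = T0 a z := lsv_left h
      rw [this, ← hst, (T0_strictMono ha).le_iff_le (show (0:ℝ) ≤ z from hz.1.le) (show (0:ℝ) ≤ s from hs.1)]
      simp only [h, not_true_eq_false, and_false, or_false]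
    · rw [lsv_right h]
      have : ¬ z ≤ s := fun h' => h (h'.trans hs.2)
      simp only [this, h, false_or, not_false_eq_true, and_true]
      constructor <;> intro <;> linarith
  · rw [Set.disjoint_left]
    rintro x hx ⟨_, h2⟩
    exact h2 (le_trans hx hs.2)

lemma GG_props {a : ℝ} (ha : 0 < a) (ha1 : a < 1) (k : ℕ) :
    ConcaveOn ℝ (Icc 0 1) (GG a k) ∧
    ∀ t ∈ Icc (0:ℝ) 1, GG a k t ≤ 4 / (1 - a) * t ^ (1 - a) := by
  induction k with
  | zero =>
    have e : ∀ t ∈ Icc (0:ℝ) 1, GG a 0 t = t := by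
      intro t ht
      unfold GG
      simp only [Function.iterate_zero, id]
      rw [measureReal_restrict_apply (show MeasurableSet {x : ℝ | x ≤ t} from measurableSet_Iic)]
      have : {x : ℝ | x ≤ t} ∩ Ioc 0 1 = Ioc 0 t := by
        ext x; simp only [mem_inter_iff, mem_ofPred_eq, mem_Ioc]
        constructor
        · rintro ⟨h1, h2, h3⟩; exact ⟨h2, h1⟩
        · rintro ⟨h1, h2⟩; exact ⟨h2, h1, h2.trans ht.2⟩
      rw [this]; simp [ht.1]
    refine ⟨(concaveOn_id (convex_Icc 0 1)).congr (fun t ht => (e t ht).symm), ?_⟩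
    intro t ht
    rw [e t ht]
    have h1 : t ≤ t ^ (1 - a) := by
      rcases eq_or_lt_of_le ht.1 with h | h
      · rw [← h]; exact Real.rpow_nonneg le_rfl _
      · nth_rewrite 1 [← Real.rpow_one t]
        exact Real.rpow_le_rpow_of_exponent_ge h ht.2 (by linarith)
    have h2 : 1 ≤ 4 / (1 - a) := by rw [le_div_iff₀ (by linarith)]; linarith
    have := Real.rpow_nonneg ht.1 (1 - a)
    nlinarith
  | succ k ih =>
    obtain ⟨hc, hb⟩ := ih
    refine ⟨⟨convex_Icc 0 1, ?_⟩, ?_⟩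
    · intro x hx y hy p q hp hq hpq
      have hxy : p • x + q • y ∈ Icc (0:ℝ) 1 := convex_Icc 0 1 hx hy hp hq hpq
      obtain ⟨sx, hsx, ex⟩ := T0_surj ha hx
      obtain ⟨sy, hsy, ey⟩ := T0_surj ha hy
      obtain ⟨sz, hsz, ez⟩ := T0_surj ha hxy
      rw [GG_succ ha k hx hsx ex, GG_succ ha k hy hsy ey, GG_succ ha k hxy hsz ez]
      have hsxy : p • sx + q • sy ∈ Icc (0:ℝ) (1/2) := convex_Icc _ _ hsx hsy hp hq hpq
      have h1 : p • sx + q • sy ≤ sz := by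
        rw [← (T0_strictMono ha).le_iff_le (show (0:ℝ) ≤ _ from hsxy.1) (show (0:ℝ) ≤ sz from hsz.1), ez,
          ← ex, ← ey]
        exact (T0_convex ha).2 hsx.1 hsy.1 hp hq hpq
      have h2 := hc.2 (x := sx) (y := sy) ⟨hsx.1, by linarith [hsx.2]⟩ ⟨hsy.1, by linarith [hsy.2]⟩ hp hq hpq
      have h3 := hc.2 (x := (1+x)/2) (y := (1+y)/2) ⟨by linarith [hx.1], by linarith [hx.2]⟩
        ⟨by linarith [hy.1], by linarith [hy.2]⟩ hp hq hpq
      have h4 := GG_mono a k h1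
      have e : p • ((1+x)/2) + q • ((1+y)/2) = (1 + (p • x + q • y))/2 := by
        simp only [smul_eq_mul]
        linear_combination hpq / 2
      rw [e] at h3
      simp only [smul_eq_mul] at *
      have e5 : p * GG a k (1/2) + q * GG a k (1/2) = GG a k (1/2) := by rw [← add_mul, hpq, one_mul]
      linarith
    · intro t ht
      obtain ⟨s, hs, e⟩ := T0_surj ha ht
      rw [GG_succ ha k ht hs e]
      have h1 := hb s ⟨hs.1, by linarith [hs.2]⟩
      have h2 := pow_gain ha ha1 hs.1 hs.2
      rw [e] at h2
      have h3 : GG a k ((1+t)/2) ≤ (1 + t) * GG a k (1/2) := by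
        have ht1 : 0 < 1 + t := by linarith [ht.1]
        have := hc.2 (show (1+t)/2 ∈ Icc (0:ℝ) 1 from ⟨by linarith, by linarith [ht.2]⟩)
          (show (0:ℝ) ∈ Icc (0:ℝ) 1 by norm_num)
          (show 0 ≤ 1/(1+t) by positivity) (show 0 ≤ t/(1+t) from div_nonneg ht.1 ht1.le)
          (by field_simp)
        rw [GG_zero ha] at this
        simp only [smul_eq_mul, mul_zero, add_zero] at this
        have e : 1 / (1 + t) * ((1 + t)/2) = 1/2 := by field_simp
        rw [e, one_div, inv_mul_le_iff₀ ht1] at this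
        exact this
      have h4 := GG_le_one a k (1/2)
      nlinarith [ht.1]

lemma exists_t0 {a : ℝ} (ha : 0 < a) (ha1 : a < 1) {ε : ℝ} (hε : 0 < ε) :
    ∃ t : ℝ, 0 < t ∧ t < 1/2 ∧ t < ε ∧ ∀ k, GG a k t ≤ 1/2 := by
  have h1 : Filter.Tendsto (fun t : ℝ => 4 / (1 - a) * t ^ (1 - a)) (nhdsWithin 0 (Ioi 0))
      (nhds (4 / (1 - a) * 0 ^ (1 - a))) := by
    have : Continuous (fun t : ℝ => 4 / (1 - a) * t ^ (1 - a)) :=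
      continuous_const.mul (Real.continuous_rpow_const (by linarith))
    exact (this.tendsto 0).mono_left nhdsWithin_le_nhds
  rw [Real.zero_rpow (by linarith), mul_zero] at h1
  have h2 := h1.eventually (gt_mem_nhds (show (0:ℝ) < 1/2 by norm_num))
  have h3 : ∀ᶠ t : ℝ in nhdsWithin 0 (Ioi 0), t ∈ Ioo (0:ℝ) (min (1/2) ε) :=
    Ioo_mem_nhdsGT (by positivity)
  obtain ⟨t, h4, h5⟩ := (h2.and h3).exists
  have h6 := lt_min_iff.1 h5.2
  exact ⟨t, h5.1, h6.1, h6.2, fun k => ((GG_props ha ha1 k).2 t ⟨h5.1.le, by linarith⟩).trans h4.le⟩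


noncomputable def RR (a t θ : ℝ) : ℕ → ℝ → ℝ
  | 0, _ => 0
  | n+1, x => if t < (lsv a)^[n] x then θ * (RR a t θ n x + 1) else RR a t θ n x + 1

noncomputable def QQ (a t l : ℝ) : ℕ → ℝ → ℝ
  | 0, _ => 1
  | n+1, x => if t < (lsv a)^[n] x then l⁻¹ * QQ a t l n x else QQ a t l n x

lemma RR_meas (a t θ : ℝ) (n : ℕ) : Measurable (RR a t θ n) := by
  induction n with
  | zero => exact measurable_const
  | succ n ih =>
    refine Measurable.ite (measurableSet_lt measurable_const (iter_measurable a n)) ?_ ?_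
    · exact (ih.add_const 1).const_mul θ
    · exact ih.add_const 1

lemma RR_bound {a t θ : ℝ} (h0 : 0 < θ) (h1 : θ < 1) (n : ℕ) (x : ℝ) :
    0 ≤ RR a t θ n x ∧ RR a t θ n x ≤ n := by
  induction n with
  | zero => simp [RR]
  | succ n ih =>
    obtain ⟨h2, h3⟩ := ih
    simp only [RR]
    push_cast
    split_ifs
    · exact ⟨by positivity, by nlinarith⟩
    · exact ⟨by positivity, by linarith⟩

lemma RR_int {a t θ : ℝ} (h0 : 0 < θ) (h1 : θ < 1) (n : ℕ) :
    Integrable (RR a t θ n) (volume.restrict (Ioc (0:ℝ) 1)) := by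
  refine Integrable.of_bound (RR_meas a t θ n).aestronglyMeasurable n ?_
  filter_upwards with x
  obtain ⟨h2, h3⟩ := RR_bound h0 h1 (a := a) (t := t) n x
  rw [Real.norm_eq_abs, abs_of_nonneg h2]; exact h3

lemma freq_good {a t θ : ℝ} (h0 : 0 < θ) (h1 : θ < 1)
    (hG : ∀ k, GG a k t ≤ 1/2) :
    ¬ ∀ᵐ x ∂(volume.restrict (Ioc (0:ℝ) 1)), ∀ᶠ N in Filter.atTop,
      ¬ (t < (lsv a)^[N] x ∧ RR a t θ N x ≤ 4 / (1 - θ)) := by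
  intro hae
  set μ := volume.restrict (Ioc (0:ℝ) 1)
  set E : ℕ → Set ℝ := fun N => {x | t < (lsv a)^[N] x ∧ RR a t θ N x ≤ 4 / (1 - θ)} with hE
  have hEm : ∀ N, MeasurableSet (E N) := fun N =>
    (measurableSet_lt measurable_const (iter_measurable a N)).inter
      (measurableSet_le (RR_meas a t θ N) measurable_const)
  have hlim : Filter.Tendsto (fun N => μ (E N)) Filter.atTop (nhds (μ ∅)) := by
    refine tendsto_measure_of_ae_tendsto_indicator_of_isFiniteMeasure _ MeasurableSet.empty hEm ?_
    filter_upwards [hae] with x hx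
    filter_upwards [hx] with N hN
    exact iff_of_false hN id
  have hlim2 : Filter.Tendsto (fun N => μ.real (E N)) Filter.atTop (nhds 0) := by
    have := (ENNReal.tendsto_toReal (a := μ ∅) (by simp)).comp hlim
    rw [measure_empty, ENNReal.toReal_zero] at this
    exact this
  have hev := hlim2.eventually (gt_mem_nhds (show (0:ℝ) < 1/8 by norm_num))
  obtain ⟨N0, hN0⟩ := Filter.eventually_atTop.1 hev
  have hstep : ∀ N, N0 ≤ N → ∫ x, RR a t θ (N+1) x ∂μ ≤ ∫ x, RR a t θ N x ∂μ - 1/2 := by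
    intro N hN
    set A := {x | (lsv a)^[N] x ≤ t} with hA
    have hAm : MeasurableSet A := measurableSet_le (iter_measurable a N) measurable_const
    have hpt : ∀ x, RR a t θ (N+1) x ≤ RR a t θ N x - 3 + 4 * (A.indicator (fun _ => (1:ℝ)) x)
        + 4 * ((E N).indicator (fun _ => (1:ℝ)) x) := by
      intro x
      obtain ⟨h2, h3⟩ := RR_bound h0 h1 (a := a) (t := t) N x
      simp only [RR]
      have i1 : 0 ≤ A.indicator (fun _ => (1:ℝ)) x := indicator_nonneg (fun _ _ => zero_le_one) x
      have i2 : 0 ≤ (E N).indicator (fun _ => (1:ℝ)) x := indicator_nonneg (fun _ _ => zero_le_one) x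
      by_cases hx : t < (lsv a)^[N] x
      · rw [if_pos hx]
        by_cases hK : RR a t θ N x ≤ 4 / (1 - θ)
        · have : x ∈ E N := ⟨hx, hK⟩
          rw [indicator_of_mem this]
          nlinarith
        · push Not at hK
          rw [div_lt_iff₀ (by linarith)] at hK
          nlinarith
      · rw [if_neg hx]
        have : x ∈ A := not_lt.1 hx
        rw [indicator_of_mem this]
        linarith
    have iA : Integrable (A.indicator (fun _ => (1:ℝ))) μ := (integrable_const 1).indicator hAm
    have iE : Integrable ((E N).indicator (fun _ => (1:ℝ))) μ := (integrable_const 1).indicator (hEm N)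
    have iR : Integrable (RR a t θ N) μ := RR_int h0 h1 N
    have i3 : Integrable (fun x => RR a t θ N x - 3) μ := iR.sub (integrable_const 3)
    have i4 : Integrable (fun x => RR a t θ N x - 3 + 4 * (A.indicator (fun _ => (1:ℝ)) x)) μ :=
      i3.add (iA.const_mul 4)
    have := integral_mono (RR_int h0 h1 (a := a) (t := t) (N+1))
      (i4.add (iE.const_mul 4)) hpt
    refine this.trans ?_
    have e : ∫ x, ((RR a t θ N x - 3 + 4 * (A.indicator (fun _ => (1:ℝ)) x))
        + 4 * ((E N).indicator (fun _ => (1:ℝ)) x)) ∂μ =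
        ∫ x, RR a t θ N x ∂μ - 3 + 4 * μ.real A + 4 * μ.real (E N) := by
      rw [integral_add i4 (iE.const_mul 4),
        integral_add i3 (iA.const_mul 4),
        integral_sub iR (integrable_const 3), integral_const_mul, integral_const_mul,
        integral_indicator_const _ hAm, integral_indicator_const _ (hEm N)]
      simp [μ]
    have hA2 : μ.real A ≤ 1/2 := hG N
    have hE2 := hN0 N hN
    change ∫ x, ((RR a t θ N x - 3 + 4 * (A.indicator (fun _ => (1:ℝ)) x))
        + 4 * ((E N).indicator (fun _ => (1:ℝ)) x)) ∂μ ≤ _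
    rw [e]
    linarith
  have hall : ∀ n : ℕ, ∫ x, RR a t θ (N0+n) x ∂μ ≤ ∫ x, RR a t θ N0 x ∂μ - n / 2 := by
    intro n
    induction n with
    | zero => simp
    | succ n ih =>
      have := hstep (N0 + n) (by omega)
      push_cast
      rw [← add_assoc]
      linarith
  obtain ⟨n, hn⟩ := exists_nat_gt (2 * ∫ x, RR a t θ N0 x ∂μ)
  have h3 := hall n
  have h4 : 0 ≤ ∫ x, RR a t θ (N0+n) x ∂μ := integral_nonneg fun x => (RR_bound h0 h1 _ x).1
  linarith

lemma QQ_pos {a t l : ℝ} (hl : 1 < l) (n : ℕ) (x : ℝ) : 0 < QQ a t l n x := by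
  induction n with
  | zero => simp [QQ]
  | succ n ih =>
    simp only [QQ]
    split_ifs
    · positivity
    · exact ih

lemma QQ_anti {a t l : ℝ} (hl : 1 < l) (x : ℝ) : Antitone (fun n => QQ a t l n x) := by
  refine antitone_nat_of_succ_le fun n => ?_
  simp only [QQ]
  have := QQ_pos hl n x (a := a) (t := t)
  split_ifs
  · have : l⁻¹ ≤ 1 := inv_le_one_of_one_le₀ hl.le
    nlinarith
  · exact le_rfl

lemma QQ_small {a t l : ℝ} (hl : 1 < l) (x : ℝ)
    (hf : ∃ᶠ N in Filter.atTop, t < (lsv a)^[N] x) {r : ℝ} (hr : 0 < r) :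
    ∀ᶠ N in Filter.atTop, QQ a t l N x < r := by
  have h : ∀ m : ℕ, ∃ N, QQ a t l N x ≤ l⁻¹ ^ m := by
    intro m
    induction m with
    | zero => exact ⟨0, by simp [QQ]⟩
    | succ m ih =>
      obtain ⟨N, hN⟩ := ih
      obtain ⟨n, hn, hn2⟩ := Filter.frequently_atTop.1 hf N
      refine ⟨n+1, ?_⟩
      simp only [QQ, if_pos hn2]
      rw [pow_succ']
      have := (QQ_anti hl x (a := a) (t := t) hn).trans hN
      have : 0 < l⁻¹ := by positivity
      gcongr
  obtain ⟨m, hm⟩ := exists_pow_lt_of_lt_one hr (inv_lt_one_of_one_lt₀ hl)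
  obtain ⟨N, hN⟩ := h m
  filter_upwards [Filter.eventually_ge_atTop N] with n hn
  exact ((QQ_anti hl x (a := a) (t := t) hn).trans hN).trans_lt hm

lemma step_abs {a p q : ℝ} (ha : 0 < a) (hp : p ∈ Ioc (0:ℝ) 1) (hq : q ∈ Ioc (0:ℝ) 1)
    (hs : p ≤ 1/2 ↔ q ≤ 1/2) : |p - q| ≤ |lsv a p - lsv a q| := by
  rcases le_total p q with h | h
  · have := step_mono ha hp.1 h hs
    rw [abs_of_nonpos (by linarith), abs_of_nonpos (by linarith)]; linarith
  · have := step_mono ha hq.1 h hs.symm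
    rw [abs_of_nonneg (by linarith), abs_of_nonneg (by linarith)]; linarith

lemma step_abs_expand {a p q t : ℝ} (ha : 0 < a) (hp : p ∈ Ioc (0:ℝ) 1) (hq : q ∈ Ioc (0:ℝ) 1)
    (hs : p ≤ 1/2 ↔ q ≤ 1/2) (ht : 0 < t) (ht2 : t ≤ 1/2) (htp : t < p) :
    (1 + (2:ℝ) ^ a * t ^ a) * |p - q| ≤ |lsv a p - lsv a q| := by
  rcases le_total p q with h | h
  · have := step_mono ha hp.1 h hs
    have := step_expand ha hp.1 h ht ht2 (htp.le.trans h) hs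
    rw [abs_of_nonpos (by linarith), abs_of_nonpos (by linarith)]; linarith
  · have := step_mono ha hq.1 h hs.symm
    have := step_expand ha hq.1 h ht ht2 htp.le hs.symm
    rw [abs_of_nonneg (by linarith), abs_of_nonneg (by linarith)]; linarith

lemma pair_est {a t γ C : ℝ} (ha : 0 < a) (hγ : 0 < γ) (hC : 0 ≤ C) (ht : 0 < t) (ht2 : t ≤ 1/2)
    {f : ℝ → ℝ} (hf : ∀ p ∈ Ioc (0:ℝ) 1, ∀ q ∈ Ioc (0:ℝ) 1, (p ≤ 1/2 ↔ q ≤ 1/2) →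
      |f p - f q| ≤ C * |p - q| ^ γ) {l θ : ℝ} (hl : l = 1 + (2:ℝ) ^ a * t ^ a)
    (hθ : θ = (l ^ γ)⁻¹) (hθ1 : θ < 1) {N : ℕ} {x y : ℝ} (hx : x ∈ Ioc (0:ℝ) 1)
    (hy : y ∈ Ioc (0:ℝ) 1) (h : Same a N x y) :
    |x - y| ≤ QQ a t l N x * |(lsv a)^[N] x - (lsv a)^[N] y| ∧
    |∑ k ∈ Finset.range N, f ((lsv a)^[k] x) - ∑ k ∈ Finset.range N, f ((lsv a)^[k] y)|
      ≤ C * RR a t θ N x * |(lsv a)^[N] x - (lsv a)^[N] y| ^ γ := by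
  have hl1 : 1 < l := by rw [hl]; linarith [s_pos (a := a) ht]
  have hθ0 : 0 < θ := by rw [hθ]; positivity
  induction N with
  | zero => simp [QQ, RR]
  | succ n ih =>
    obtain ⟨h1, h2⟩ := ih h.pred
    rw [Function.iterate_succ_apply', Function.iterate_succ_apply', Finset.sum_range_succ,
      Finset.sum_range_succ]
    simp only [QQ, RR]
    set p := (lsv a)^[n] x
    set q := (lsv a)^[n] y
    have hp : p ∈ Ioc (0:ℝ) 1 := iter_mem ha hx n
    have hq : q ∈ Ioc (0:ℝ) 1 := iter_mem ha hy n
    have hs : p ≤ 1/2 ↔ q ≤ 1/2 := h n (by omega)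
    have g1 := step_abs ha hp hq hs
    have hQ := QQ_pos hl1 n x (a := a) (t := t)
    have hR := (RR_bound hθ0 hθ1 n x (a := a) (t := t)).1
    have hfpq := hf p hp q hq hs
    set S := ∑ k ∈ Finset.range n, f ((lsv a)^[k] x)
    set S' := ∑ k ∈ Finset.range n, f ((lsv a)^[k] y)
    have hsum : |S + f p - (S' + f q)| ≤ C * (RR a t θ n x + 1) * |p - q| ^ γ := by
      have : S + f p - (S' + f q) = (S - S') + (f p - f q) := by ring
      rw [this]
      refine (abs_add_le _ _).trans ?_
      linarith
    split_ifs with htp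
    · have g2 := step_abs_expand ha hp hq hs ht ht2 htp
      rw [← hl] at g2
      have g3 : |p - q| ≤ l⁻¹ * |lsv a p - lsv a q| := by
        rw [inv_mul_eq_div, le_div_iff₀ (by linarith)]; linarith
      constructor
      · refine h1.trans ?_
        have := mul_le_mul_of_nonneg_left g3 hQ.le
        linarith
      · refine hsum.trans ?_
        have g4 : |p - q| ^ γ ≤ θ * |lsv a p - lsv a q| ^ γ := by
          have := Real.rpow_le_rpow (abs_nonneg _) g3 hγ.le
          rwa [Real.mul_rpow (by positivity) (abs_nonneg _), Real.inv_rpow (by linarith), ← hθ] at this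
        have : 0 ≤ C * (RR a t θ n x + 1) := by positivity
        have := mul_le_mul_of_nonneg_left g4 this
        linarith
    · constructor
      · refine h1.trans ?_
        gcongr
      · refine hsum.trans ?_
        gcongr


lemma density_real {S : Set ℝ} (hS : MeasurableSet S) {x : ℝ}
    (h : Filter.Tendsto (fun r => volume (S ∩ Metric.closedBall x r) / volume (Metric.closedBall x r))
      (nhdsWithin 0 (Ioi 0)) (nhds 1)) {ε : ℝ} (hε : 0 < ε) :
    ∃ r0 > 0, ∀ r, 0 < r → r < r0 →
      volume (Metric.closedBall x r \ S) ≤ ENNReal.ofReal (ε * r) := by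
  have h2 := (ENNReal.tendsto_toReal (a := 1) (by simp)).comp h
  have h3 := h2.eventually (lt_mem_nhds (show 1 - ε/2 < (1:ENNReal).toReal by
    rw [ENNReal.toReal_one]; linarith))
  obtain ⟨r0, hr0, h4⟩ := (mem_nhdsGT_iff_exists_Ioo_subset).1 h3
  refine ⟨r0, hr0, fun r hr hr' => ?_⟩
  have h5 : 1 - ε/2 < (volume (S ∩ Metric.closedBall x r) / volume (Metric.closedBall x r)).toReal :=
    h4 ⟨hr, hr'⟩
  rw [ENNReal.toReal_div, Real.volume_closedBall, ENNReal.toReal_ofReal (by linarith),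
    lt_div_iff₀ (by linarith)] at h5
  have hfin : volume (Metric.closedBall x r \ S) ≠ ⊤ :=
    ((measure_mono sdiff_subset).trans_lt measure_closedBall_lt_top).ne
  have h6 : volume.real (S ∩ Metric.closedBall x r) + volume.real (Metric.closedBall x r \ S)
      = volume.real (Metric.closedBall x r) := by
    rw [inter_comm]
    exact measureReal_inter_add_sdiff hS measure_closedBall_lt_top.ne
  have h7 : volume.real (Metric.closedBall x r) = 2 * r := by
    rw [Measure.real, Real.volume_closedBall, ENNReal.toReal_ofReal (by linarith)]
  rw [← ENNReal.ofReal_toReal hfin]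
  apply ENNReal.ofReal_le_ofReal
  change volume.real _ ≤ _
  have h5' : (1 - ε / 2) * (2 * r) < volume.real (S ∩ Metric.closedBall x r) := h5
  linarith

lemma ess_abstract {t M1 : ℝ} (ht : t < 1) {u : ℝ → ℝ}
    (h : ∀ ε > 0, ∃ s : ℝ, ∃ W : Set ℝ, volume W ≤ ENNReal.ofReal ε ∧
      ∀ w ∈ Ioc t 1, w ∉ W → |u w + s| ≤ M1) :
    ∃ B, ∀ᵐ w ∂(volume.restrict (Ioc (0:ℝ) 1)), t < w → |u w| ≤ B := by
  obtain ⟨M0, hM0⟩ : ∃ M0 : ℕ, volume {w | w ∈ Ioc t 1 ∧ |u w| ≤ M0} ≠ 0 := by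
    by_contra! hcon
    have h1 := measure_iUnion_null hcon
    have h2 : Ioc t 1 ⊆ ⋃ i : ℕ, {w | w ∈ Ioc t 1 ∧ |u w| ≤ i} := by
      intro w hw
      obtain ⟨n, hn⟩ := exists_nat_ge |u w|
      exact mem_iUnion.2 ⟨n, hw, hn⟩
    have h3 := measure_mono_null h2 h1
    rw [Real.volume_Ioc, ENNReal.ofReal_eq_zero] at h3
    linarith
  set η := volume {w | w ∈ Ioc t 1 ∧ |u w| ≤ M0} with hη
  have hηfin : η ≠ ⊤ :=
    ((measure_mono (fun w hw => hw.1)).trans_lt (measure_Ioc_lt_top (a := t) (b := (1:ℝ)))).ne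
  have hη' : 0 < η.toReal := ENNReal.toReal_pos hM0 hηfin
  refine ⟨M0 + 2 * M1, ?_⟩
  rw [ae_restrict_iff' measurableSet_Ioc, ae_iff]
  have key : ∀ ε, 0 < ε → ε < η.toReal →
      volume {w | ¬ (w ∈ Ioc (0:ℝ) 1 → t < w → |u w| ≤ M0 + 2 * M1)} ≤ ENNReal.ofReal ε := by
    intro ε hε hε2
    obtain ⟨s, W, hW, hs⟩ := h ε hε
    have hex : ∃ w ∈ Ioc t 1, |u w| ≤ M0 ∧ w ∉ W := by
      by_contra! hcon
      have : η ≤ ENNReal.ofReal ε := (measure_mono (fun w hw => hcon w hw.1 hw.2)).trans hW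
      have := ENNReal.toReal_mono ENNReal.ofReal_ne_top this
      rw [ENNReal.toReal_ofReal hε.le] at this
      linarith
    obtain ⟨w, hw, hw1, hw2⟩ := hex
    have h3 := hs w hw hw2
    refine (measure_mono ?_).trans hW
    intro z hz
    simp only [mem_ofPred_eq, Classical.not_imp] at hz
    obtain ⟨hz1, hz2, hz3⟩ := hz
    by_contra hzW
    have h4 := hs z ⟨hz2, hz1.2⟩ hzW
    apply hz3
    rw [abs_le] at *
    constructor <;> linarith [h3.1, h3.2, h4.1, h4.2, hw1.1, hw1.2]
  by_contra hne
  set v := volume {w | ¬ (w ∈ Ioc (0:ℝ) 1 → t < w → |u w| ≤ M0 + 2 * M1)} with hv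
  have hvfin : v ≠ ⊤ := ((key (η.toReal/2) (by linarith) (by linarith)).trans_lt ENNReal.ofReal_lt_top).ne
  have hv' : 0 < v.toReal := ENNReal.toReal_pos hne hvfin
  have := key (min (η.toReal/2) (v.toReal/2)) (by positivity)
    ((min_le_left _ _).trans_lt (by linarith))
  have := ENNReal.toReal_mono ENNReal.ofReal_ne_top this
  rw [ENNReal.toReal_ofReal (by positivity)] at this
  have := min_le_right (η.toReal/2) (v.toReal/2)
  linarith

lemma ess_bdd {a t γ C : ℝ} (ha : 0 < a) (ha1 : a < 1) (hγ : 0 < γ) (hC : 0 ≤ C) (ht : 0 < t)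
    (ht2 : t < 1/2)
    {f : ℝ → ℝ} (hf : ∀ p ∈ Ioc (0:ℝ) 1, ∀ q ∈ Ioc (0:ℝ) 1, (p ≤ 1/2 ↔ q ≤ 1/2) →
      |f p - f q| ≤ C * |p - q| ^ γ) (hG : ∀ k, GG a k t ≤ 1/2)
    {u : ℝ → ℝ} (hu : Measurable u)
    (hcob : ∀ᵐ x ∂(volume.restrict (Ioc (0:ℝ) 1)), f x = u x - u (lsv a x)) :
    ∃ B, ∀ᵐ w ∂(volume.restrict (Ioc (0:ℝ) 1)), t < w → |u w| ≤ B := by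
  obtain ⟨l, hl⟩ : ∃ l, l = 1 + (2:ℝ) ^ a * t ^ a := ⟨_, rfl⟩
  obtain ⟨θ, hθ⟩ : ∃ θ, θ = (l ^ γ)⁻¹ := ⟨_, rfl⟩
  have hl1 : 1 < l := by rw [hl]; linarith [s_pos (a := a) ht]
  have hθ0 : 0 < θ := by rw [hθ]; positivity
  have hθ1 : θ < 1 := by rw [hθ]; exact inv_lt_one_of_one_lt₀ (Real.one_lt_rpow hl1 hγ)
  -- the generic set
  set P : ℝ → Prop := fun y => ∀ N : ℕ,
    u ((lsv a)^[N] y) = u y - ∑ k ∈ Finset.range N, f ((lsv a)^[k] y) with hPdef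
  have hP : ∀ᵐ y ∂(volume.restrict (Ioc (0:ℝ) 1)), P y := by
    filter_upwards [ae_iter ha hcob] with y hy N
    induction N with
    | zero => simp
    | succ n ih =>
      have := hy n
      rw [Finset.sum_range_succ, Function.iterate_succ_apply']
      linarith
  have hSm : ∀ M : ℕ, MeasurableSet {y | |u y| ≤ M} := fun M =>
    measurableSet_le (by fun_prop) measurable_const
  have hdens : ∀ᵐ x ∂(volume.restrict (Ioc (0:ℝ) 1)), ∀ M : ℕ, |u x| ≤ M →
      Filter.Tendsto (fun r => volume ({y | |u y| ≤ M} ∩ Metric.closedBall x r)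
        / volume (Metric.closedBall x r)) (nhdsWithin 0 (Ioi 0)) (nhds 1) := by
    rw [ae_all_iff]
    intro M
    apply ae_restrict_of_ae
    exact (ae_restrict_iff' (hSm M)).1 (Besicovitch.ae_tendsto_measure_inter_div volume {y | |u y| ≤ M})
  have hfreq := freq_good hθ0 hθ1 hG
  have hmem : ∀ᵐ x ∂(volume.restrict (Ioc (0:ℝ) 1)), x ∈ Ioc (0:ℝ) 1 :=
    ae_restrict_mem measurableSet_Ioc
  obtain ⟨x, hxf, hxd, hx⟩ := ((Filter.not_eventually.1 hfreq).and_eventually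
    (hdens.and hmem)).exists
  have hxf2 : ∃ᶠ N in Filter.atTop, (t < (lsv a)^[N] x ∧ RR a t θ N x ≤ 4 / (1 - θ)) := hxf
  obtain ⟨M, hM⟩ := exists_nat_ge |u x|
  have hD := hxd M hM
  set K := 4 / (1 - θ) with hK
  have hK0 : 0 ≤ K := div_nonneg (by norm_num) (by linarith)
  refine ess_abstract (M1 := M + C * K) (by linarith) ?_
  intro ε hε
  set Γ := Real.exp (4 / t) with hΓ
  have hΓ0 : 0 < Γ := Real.exp_pos _
  obtain ⟨r0, hr0, hr⟩ := density_real (hSm M) hD (ε := ε / Γ) (by positivity)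
  obtain ⟨N, ⟨hN1, hN2⟩, hN3⟩ := (hxf2.and_eventually
    (QQ_small hl1 x (hxf2.mono fun N h => h.1) hr0)).exists
  obtain ⟨p, hp, hpS, hpT⟩ := same_surj ha N (w := t) ⟨ht, by linarith⟩ x hx
  obtain ⟨q, hq, hqS, hqT⟩ := same_surj ha N (w := 1) ⟨one_pos, le_rfl⟩ x hx
  have hTx := iter_mem ha hx N
  have hpx : p ≤ x := (same_le_iff ha hp hx hpS.symm).2 (by rw [hpT]; exact hN1.le)
  have hxq : x ≤ q := (same_le_iff ha hx hq hqS).2 (by rw [hqT]; exact hTx.2)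
  have hpq : p < q := by
    refine lt_of_le_of_ne (hpx.trans hxq) ?_
    rintro rfl
    rw [hpT] at hqT
    linarith
  set ρ := max (q - x) (x - p) with hρ
  have hρ0 : 0 < ρ := by
    rcases eq_or_lt_of_le hpx with h | h
    · exact lt_max_of_lt_left (by linarith)
    · exact lt_max_of_lt_right (by linarith)
  have hρpq : ρ ≤ q - p := max_le (by linarith) (by linarith)
  have hQ0 := QQ_pos hl1 N x (a := a) (t := t)
  have hbd : ∀ y ∈ Ioc (0:ℝ) 1, |(lsv a)^[N] x - (lsv a)^[N] y| ≤ 1 := by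
    intro y hy
    have := iter_mem ha hy N
    rw [abs_le]; constructor <;> linarith [this.1, this.2, hTx.1, hTx.2]
  have hsmall : ∀ y ∈ Ioc (0:ℝ) 1, Same a N x y → |x - y| < r0 := by
    intro y hy hS
    have h1 := (pair_est ha hγ hC ht ht2.le hf hl hθ hθ1 hx hy hS).1
    have := mul_le_mul_of_nonneg_left (hbd y hy) hQ0.le
    linarith
  have hρr : ρ < r0 := by
    apply max_lt
    · have := hsmall q hq hqS
      rw [abs_of_nonpos (by linarith)] at this; linarith
    · have := hsmall p hp hpS
      rw [abs_of_nonneg (by linarith)] at this; linarith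
  have hball := hr ρ hρ0 hρr
  set V := {y | y ∈ Ioc (0:ℝ) 1 ∧ Same a N x y ∧ t ≤ (lsv a)^[N] y ∧ ¬ (|u y| ≤ M ∧ P y)} with hV
  have hVvol : volume V ≤ ENNReal.ofReal (ε / Γ * ρ) := by
    have hnull : volume {y | ¬ (y ∈ Ioc (0:ℝ) 1 → P y)} = 0 := by
      rw [ae_restrict_iff' measurableSet_Ioc, ae_iff] at hP
      exact hP
    have hsub : V ⊆ (Metric.closedBall x ρ \ {y | |u y| ≤ M}) ∪ {y | ¬ (y ∈ Ioc (0:ℝ) 1 → P y)} := by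
      rintro y ⟨hy, hyS, hyt, hyn⟩
      by_cases hPy : P y
      · left
        refine ⟨?_, fun h => hyn ⟨h, hPy⟩⟩
        have h1 : p ≤ y := (same_le_iff ha hp hy (hpS.symm.trans hyS)).2 (by rw [hpT]; exact hyt)
        have h2 : y ≤ q := (same_le_iff ha hy hq (hyS.symm.trans hqS)).2
          (by rw [hqT]; exact (iter_mem ha hy N).2)
        rw [Metric.mem_closedBall, Real.dist_eq, abs_le]
        have := le_max_left (q - x) (x - p)
        have := le_max_right (q - x) (x - p)
        constructor <;> linarith
      · right
        exact fun h => hPy (h hy)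
    refine (measure_mono hsub).trans ((measure_union_le _ _).trans ?_)
    rw [hnull, add_zero]
    exact hball
  have hDp := DN_pos ha N hp
  have hDbound : ∀ y ∈ V, DN a N y ≤ Γ / ρ := by
    rintro y ⟨hy, hyS, hyt, hyn⟩
    have h1 : p ≤ y := (same_le_iff ha hp hy (hpS.symm.trans hyS)).2 (by rw [hpT]; exact hyt)
    obtain ⟨_, _, _, h2⟩ := DN_bounds ha ha1 hp hy (hpS.symm.trans hyS) h1
    obtain ⟨h3, _⟩ := DN_bounds ha ha1 hp hq (hpS.symm.trans hqS) hpq.le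
    rw [hpT, hqT] at h3
    have h4 : Real.exp (4 * (((lsv a)^[N] y - (lsv a)^[N] p) / (lsv a)^[N] p - (y - p) / p)) ≤ Γ := by
      apply Real.exp_le_exp.2
      rw [hpT]
      have g1 : 0 ≤ (y - p) / p := div_nonneg (by linarith) hp.1.le
      have g2 : ((lsv a)^[N] y - t) / t ≤ 1 / t := by
        have := (iter_mem ha hy N).2
        gcongr
        linarith
      have : 4 / t = 4 * (1 / t) := by ring
      rw [this]
      linarith
    rw [le_div_iff₀ hρ0]
    have h5 := h2.trans (mul_le_mul_of_nonneg_left h4 hDp.le)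
    calc DN a N y * ρ ≤ (DN a N p * Γ) * (q - p) := by
          apply mul_le_mul h5 hρpq hρ0.le (by positivity)
      _ = (DN a N p * (q - p)) * Γ := by ring
      _ ≤ 1 * Γ := by gcongr; linarith
      _ = Γ := one_mul _
  have hLip1 : ∀ y ∈ V, ∀ z ∈ V, y ≤ z →
      |(lsv a)^[N] y - (lsv a)^[N] z| ≤ Γ / ρ * |y - z| := by
    intro y hy z hz hyz
    have hS := hy.2.1.symm.trans hz.2.1
    obtain ⟨_, h2, _, _⟩ := DN_bounds ha ha1 hy.1 hz.1 hS hyz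
    have h3 := (same_le_iff ha hy.1 hz.1 hS).1 hyz
    rw [abs_of_nonpos (by linarith), abs_of_nonpos (by linarith)]
    have := mul_le_mul_of_nonneg_right (hDbound z hz) (sub_nonneg.2 hyz)
    linarith
  have hLip : LipschitzOnWith (Real.toNNReal (Γ / ρ)) ((lsv a)^[N]) V := by
    refine LipschitzOnWith.of_dist_le_mul ?_
    intro y hy z hz
    rw [Real.dist_eq, Real.dist_eq, Real.coe_toNNReal _ (by positivity)]
    rcases le_total y z with h | h
    · exact hLip1 y hy z hz h
    · rw [abs_sub_comm, abs_sub_comm y z]; exact hLip1 z hz y hy h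
  refine ⟨∑ k ∈ Finset.range N, f ((lsv a)^[k] x), (lsv a)^[N] '' V, ?_, ?_⟩
  · refine (vol_image_le hLip).trans ?_
    refine (mul_le_mul_right hVvol _).trans ?_
    change ENNReal.ofReal _ * _ ≤ _
    rw [← ENNReal.ofReal_mul (by positivity)]
    apply ENNReal.ofReal_le_ofReal
    apply le_of_eq
    field_simp
  · intro w hw hwV
    obtain ⟨y, hy, hyS, hyT⟩ := same_surj ha N (w := w) ⟨by linarith [hw.1], hw.2⟩ x hx
    have hyg : |u y| ≤ M ∧ P y := by
      by_contra hcon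
      exact hwV ⟨y, ⟨hy, hyS, by rw [hyT]; exact hw.1.le, hcon⟩, hyT⟩
    have h1 := hyg.2 N
    rw [hyT] at h1
    have h2 := (pair_est ha hγ hC ht ht2.le hf hl hθ hθ1 hx hy hyS).2
    have hR := (RR_bound hθ0 hθ1 N x (a := a) (t := t)).1
    have h3 : |(lsv a)^[N] x - (lsv a)^[N] y| ^ γ ≤ 1 :=
      Real.rpow_le_one (abs_nonneg _) (hbd y hy) hγ.le
    have h4 : C * RR a t θ N x * |(lsv a)^[N] x - (lsv a)^[N] y| ^ γ ≤ C * K := by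
      calc _ ≤ C * RR a t θ N x * 1 := by gcongr
        _ ≤ C * K := by rw [mul_one]; gcongr
    have h5 := h2.trans h4
    rw [h1]
    set S := ∑ k ∈ Finset.range N, f ((lsv a)^[k] x)
    set S' := ∑ k ∈ Finset.range N, f ((lsv a)^[k] y)
    have : u y - S' + S = u y + (S - S') := by ring
    rw [this]
    exact (abs_add_le _ _).trans (add_le_add hyg.1 h5)

/-- If `f : [0,1] → ℝ` is Hölder continuous on `[0,1/2]` and on `(1/2,1]` and
`f 0 ≠ 0`, then `f` is not a measurable coboundary for the LSV map. -/
theorem lsv_not_coboundary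
    (a : ℝ) (ha : 0 < a) (ha1 : a < 1)
    (γ : ℝ) (hγ : 0 < γ)
    (f : ℝ → ℝ)
    (hf1 : ∃ C : ℝ, ∀ x ∈ Icc (0:ℝ) (1/2), ∀ y ∈ Icc (0:ℝ) (1/2),
      |f x - f y| ≤ C * |x - y| ^ γ)
    (hf2 : ∃ C : ℝ, ∀ x ∈ Ioc (1/2:ℝ) 1, ∀ y ∈ Ioc (1/2:ℝ) 1,
      |f x - f y| ≤ C * |x - y| ^ γ)
    (hf0 : f 0 ≠ 0) :
    ¬ ∃ u : ℝ → ℝ, Measurable u ∧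
      ∀ᵐ x ∂(volume.restrict (Icc (0:ℝ) 1)), f x = u x - u (lsv a x) := by
  rintro ⟨u, hu, hcob0⟩
  have hcob : ∀ᵐ x ∂(volume.restrict (Ioc (0:ℝ) 1)), f x = u x - u (lsv a x) :=
    ae_restrict_of_ae_restrict_of_subset Ioc_subset_Icc_self hcob0
  obtain ⟨C1, hC1⟩ := hf1
  obtain ⟨C2, hC2⟩ := hf2
  set C := max (max C1 C2) 0 with hCdef
  have hC : 0 ≤ C := le_max_right _ _
  have hCC1 : C1 ≤ C := (le_max_left _ _).trans (le_max_left _ _)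
  have hCC2 : C2 ≤ C := (le_max_right _ _).trans (le_max_left _ _)
  have hf : ∀ p ∈ Ioc (0:ℝ) 1, ∀ q ∈ Ioc (0:ℝ) 1, (p ≤ 1/2 ↔ q ≤ 1/2) →
      |f p - f q| ≤ C * |p - q| ^ γ := by
    intro p hp q hq hs
    have hnn : 0 ≤ |p - q| ^ γ := Real.rpow_nonneg (abs_nonneg _) _
    by_cases h : p ≤ 1/2
    · exact (hC1 p ⟨hp.1.le, h⟩ q ⟨hq.1.le, hs.1 h⟩).trans (by gcongr)
    · exact (hC2 p ⟨not_le.1 h, hp.2⟩ q ⟨not_le.1 (fun h' => h (hs.2 h')), hq.2⟩).trans (by gcongr)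
  have hc0 : 0 < |f 0| := abs_pos.2 hf0
  -- near zero
  obtain ⟨ε, hε, hnear⟩ : ∃ ε > 0, ∀ y, 0 < y → y < ε → y ≤ 1/2 → |f y - f 0| ≤ |f 0| / 2 := by
    have hcont : Filter.Tendsto (fun y : ℝ => C * y ^ γ) (nhdsWithin 0 (Ioi 0))
        (nhds (C * 0 ^ γ)) := by
      have : Continuous (fun y : ℝ => C * y ^ γ) :=
        continuous_const.mul (Real.continuous_rpow_const hγ.le)
      exact (this.tendsto 0).mono_left nhdsWithin_le_nhds
    rw [Real.zero_rpow hγ.ne', mul_zero] at hcont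
    have h3 := hcont.eventually (gt_mem_nhds (show 0 < |f 0| / 2 by linarith))
    obtain ⟨r0, hr0, h4⟩ := (mem_nhdsGT_iff_exists_Ioo_subset).1 h3
    refine ⟨r0, hr0, fun y hy hy2 hy3 => ?_⟩
    have h5 : C * y ^ γ < |f 0| / 2 := h4 ⟨hy, hy2⟩
    have h6 := hC1 y ⟨hy.le, hy3⟩ 0 ⟨le_rfl, by norm_num⟩
    rw [sub_zero, abs_of_pos hy] at h6
    have h7 : C1 * y ^ γ ≤ C * y ^ γ := by gcongr
    linarith
  obtain ⟨t, ht, ht2, htε, hG⟩ := exists_t0 ha ha1 hε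
  obtain ⟨B, hB⟩ := ess_bdd ha ha1 hγ hC ht ht2 hf hG hu hcob
  set F := |f 1| + C with hF
  have hFb : ∀ z ∈ Ioc (1/2:ℝ) 1, |f z| ≤ F := by
    intro z hz
    have h1 := hf z ⟨by linarith [hz.1], hz.2⟩ 1 ⟨one_pos, le_rfl⟩
      (iff_of_false (not_le.2 hz.1) (by norm_num))
    have h2 : |z - 1| ^ γ ≤ 1 := Real.rpow_le_one (abs_nonneg _)
      (by rw [abs_le]; constructor <;> linarith [hz.1, hz.2]) hγ.le
    have h3 : |f z| ≤ |f z - f 1| + |f 1| := by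
      have := abs_add_le (f z - f 1) (f 1)
      simpa using this
    nlinarith
  obtain ⟨n0, hn0⟩ := exists_nat_gt ((2 * B + F) / (|f 0| / 2))
  rw [div_lt_iff₀ (by linarith)] at hn0
  -- choose generic point
  have hgen := (ae_iter ha hcob).and ((ae_iter ha hB).and
    (ae_restrict_mem (μ := (volume : Measure ℝ)) (measurableSet_Ioc (a := (0:ℝ)) (b := 1))))
  set δ := t / 2 ^ n0 with hδ
  have hδ0 : 0 < δ := by positivity
  have hδt : δ ≤ t := div_le_self ht.le (one_le_pow₀ (by norm_num))
  obtain ⟨z, hz1, hz2, hz⟩ : ∃ z ∈ Ioo (1/2:ℝ) (1/2 + δ/2),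
      (∀ k, f ((lsv a)^[k] z) = u ((lsv a)^[k] z) - u (lsv a ((lsv a)^[k] z))) ∧
      (∀ k, t < (lsv a)^[k] z → |u ((lsv a)^[k] z)| ≤ B) := by
    by_contra! hcon
    rw [ae_restrict_iff' measurableSet_Ioc, ae_iff] at hgen
    refine absurd (measure_mono_null (s := Ioo (1/2:ℝ) (1/2 + δ/2)) ?_ hgen) ?_
    · intro z hz h
      obtain ⟨h1, h2, _⟩ := h ⟨by linarith [hz.1], by linarith [hz.2]⟩
      obtain ⟨k, hk, hk2⟩ := hcon z hz h1
      exact absurd (h2 k hk) (not_le.2 hk2)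
    · rw [Real.volume_Ioo, ENNReal.ofReal_eq_zero]
      linarith
  have hzm : z ∈ Ioc (0:ℝ) 1 := ⟨by linarith [hz1.1], by linarith [hz1.2]⟩
  have hzr : ¬ z ≤ 1/2 := not_le.2 hz1.1
  set w := lsv a z with hw
  have hwe : w = 2 * z - 1 := lsv_right hzr
  have hw0 : 0 < w := by rw [hwe]; linarith [hz1.1]
  have hwδ : w < δ := by rw [hwe]; linarith [hz1.2]
  have hwm : w ∈ Ioc (0:ℝ) 1 := lsv_mem ha hzm
  have hex : ∃ n, t < (lsv a)^[n] w := by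
    by_contra! hcon
    set L := 1 + (2:ℝ) ^ a * w ^ a with hL
    have hL1 : 1 < L := by linarith [s_pos (a := a) hw0]
    have hgrow : ∀ n : ℕ, L ^ n * w ≤ (lsv a)^[n] w := by
      intro n
      induction n with
      | zero => simp
      | succ n ih =>
        have hm := iter_mem ha hwm n
        rw [Function.iterate_succ_apply', lsv_left ((hcon n).trans ht2.le)]
        set v := (lsv a)^[n] w
        have hwv : w ≤ v := by
          have : 1 ≤ L ^ n := one_le_pow₀ hL1.le
          nlinarith
        have := s_mono ha hw0 hwv
        have h1 : L ≤ 1 + 2 ^ a * v ^ a := by linarith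
        calc L ^ (n+1) * w = (L ^ n * w) * L := by ring
          _ ≤ v * (1 + 2 ^ a * v ^ a) := mul_le_mul ih h1 (by linarith) hm.1.le
    obtain ⟨n, hn⟩ := pow_unbounded_of_one_lt (t / w) hL1
    rw [div_lt_iff₀ hw0] at hn
    linarith [hgrow n, hcon n]
  classical
  set n := Nat.find hex with hn
  have hnt : t < (lsv a)^[n] w := Nat.find_spec hex
  have hlt : ∀ k < n, (lsv a)^[k] w ≤ t := fun k hk => not_lt.1 (Nat.find_min hex hk)
  have hup : ∀ k ≤ n, (lsv a)^[k] w ≤ 2 ^ k * w := by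
    intro k
    induction k with
    | zero => simp
    | succ k ih =>
      intro hk
      have h1 := ih (by omega)
      have h2 : (lsv a)^[k] w ≤ 1/2 := (hlt k (by omega)).trans ht2.le
      have hm := iter_mem ha hwm k
      rw [Function.iterate_succ_apply', lsv_left h2]
      have := s_le ha hm.1 h2
      rw [pow_succ]
      nlinarith [hm.1]
  have hn0n : n0 ≤ n := by
    by_contra! hcon
    have h1 := hup n le_rfl
    have h2 : (2:ℝ) ^ n ≤ 2 ^ n0 := pow_le_pow_right₀ (by norm_num) hcon.le
    have h3 : (2:ℝ) ^ n0 * w < 2 ^ n0 * δ := by gcongr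
    have h4 : (2:ℝ) ^ n0 * δ = t := by rw [hδ]; field_simp
    nlinarith
  have hsum : ∀ k, u ((lsv a)^[k] w) = u w - ∑ i ∈ Finset.range k, f ((lsv a)^[i] w) := by
    intro k
    induction k with
    | zero => simp
    | succ k ih =>
      have := hz2 (k+1)
      rw [Function.iterate_succ_apply] at this
      rw [Finset.sum_range_succ, Function.iterate_succ_apply']
      linarith
  have hSn : |∑ i ∈ Finset.range n, f ((lsv a)^[i] w) - n * f 0| ≤ n * (|f 0| / 2) := by
    have e : ∑ i ∈ Finset.range n, f ((lsv a)^[i] w) - n * f 0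
        = ∑ i ∈ Finset.range n, (f ((lsv a)^[i] w) - f 0) := by simp
    rw [e]
    refine (Finset.abs_sum_le_sum_abs _ _).trans ?_
    have := Finset.sum_le_card_nsmul (Finset.range n) (fun i => |f ((lsv a)^[i] w) - f 0|)
      (|f 0| / 2) (fun i hi => by
        have hi' := hlt i (Finset.mem_range.1 hi)
        exact hnear _ (iter_mem ha hwm i).1 (by linarith) (by linarith))
    simpa using this
  have hu1 : |u z| ≤ B := hz 0 (by simpa using (by linarith [hz1.1] : t < z))
  have hu2 : |u ((lsv a)^[n] w)| ≤ B := by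
    have := hz (n+1)
    rw [Function.iterate_succ_apply] at this
    exact this hnt
  have hfz : f z = u z - u w := by simpa using hz2 0
  have hFz := hFb z ⟨hz1.1, hzm.2⟩
  have hS := hsum n
  set S := ∑ i ∈ Finset.range n, f ((lsv a)^[i] w)
  have hSb : |S| ≤ 2 * B + F := by
    rw [abs_le] at *
    constructor <;> linarith [hu1.1, hu1.2, hu2.1, hu2.2, hFz.1, hFz.2]
  have h1 : |n * f 0| ≤ |S| + n * (|f 0| / 2) := by
    have : n * f 0 = S - (S - n * f 0) := by ring
    rw [this]
    exact (abs_sub _ _).trans (by linarith)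
  rw [abs_mul, Nat.abs_cast] at h1
  have h2 : (n0:ℝ) ≤ n := by exact_mod_cast hn0n
  have h3 : (n0:ℝ) * (|f 0| / 2) ≤ n * (|f 0| / 2) := by gcongr
  linarith
end

section
/- Let T be a positive recurrent Markov shift with Hölder potential preserving a probability measure m, with separation-time metric d(x,y)=τ^{s(x,y)}, τ∈(0,1). Let f:X→G satisfy Σ_{a∈α} m(a)Df(a)<∞ and let u:X→G be measurable with f=u-u∘T a.e. Then Du(a)<∞ for every a∈α, and if T is transitive, Σ_{a∈α} m(a)Du(a)<∞. -/
open MeasureTheory Filter ENNReal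

variable {X G ι : Type*}

/-- The essential Lipschitz constant of `f` on the set `Z`. -/
noncomputable def essLip [PseudoEMetricSpace X] [PseudoEMetricSpace G] [MeasurableSpace X]
    (m : Measure X) (f : X → G) (Z : Set X) : ℝ≥0∞ :=
  sInf {C : ℝ≥0∞ | ∃ Ω : Set X, Ω ⊆ Z ∧ m (Z \ Ω) = 0 ∧
    ∀ x ∈ Ω, ∀ y ∈ Ω, edist (f x) (f y) ≤ C * edist x y}

/-- A positive recurrent Markov shift preserving the probability measure `m`, with
the separation-time metric `d(x,y) = τ^(s(x,y))`, `τ ∈ (0,1)`: it satisfies the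
Gibbs-Markov axioms (Markov partition `α`, uniform expansion by the exact factor
`τ⁻¹` on partition elements, bounded distortion) except possibly the BIP property;
all distances are powers of `τ`. -/
structure MarkovShift [MetricSpace X] [MeasurableSpace X]
    (m : Measure X) (T : X → X) (α : ι → Set X) (τ : ℝ) : Prop where
  countable : Countable ι
  bounded : Bornology.IsBounded (Set.univ : Set X)
  measT : Measurable T
  τ_pos : 0 < τ
  τ_lt_one : τ < 1
  sep : ∀ x y : X, x ≠ y → ∃ n : ℕ, dist x y = τ ^ n
  meas : ∀ i, MeasurableSet (α i)
  pos : ∀ i, 0 < m (α i)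
  disj : Pairwise (Function.onFun Disjoint α)
  cover : m (⋃ i, α i)ᶜ = 0
  inj : ∀ i, Set.InjOn T (α i)
  markov : ∀ i, ∃ s : Set ι, m (symmDiff (T '' α i) (⋃ j ∈ s, α j)) = 0
  expand : ∀ i, ∀ x ∈ α i, ∀ y ∈ α i, dist (T x) (T y) = τ⁻¹ * dist x y
  distortion : ∃ g : X → ℝ, (∀ x, 0 < g x) ∧
      (∀ i, ∀ s : Set X, s ⊆ α i → MeasurableSet s →
        m (T '' s) = ∫⁻ x in s, ENNReal.ofReal (g x)⁻¹ ∂m) ∧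
      ∃ C : ℝ, 0 < C ∧ ∀ i, ∀ x ∈ α i, ∀ y ∈ α i,
        |1 - g x / g y| ≤ C * dist (T x) (T y)

set_option linter.unusedSectionVars false

/-- Cylinder following the word `l` and ending in `a`. -/
def cylE (T : X → X) (α : ι → Set X) (a : Set X) : List ι → Set X
  | [] => a
  | i :: l => α i ∩ T ⁻¹' cylE T α a l

/-- Weighted sum of constants along a word. -/
noncomputable def wt (τ : ℝ) (c : ι → ℝ≥0∞) : List ι → ℝ≥0∞
  | [] => 0
  | i :: l => ENNReal.ofReal τ ^ (l.length + 1) * c i + wt τ c l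

section basics

variable [MetricSpace X] [MeasurableSpace X] {m : Measure X} {T : X → X} {α : ι → Set X} {τ : ℝ}

lemma MarkovShift.dist_le_one (h : MarkovShift m T α τ) (x y : X) : dist x y ≤ 1 := by
  by_cases hxy : x = y
  · simp [hxy]
  · obtain ⟨n, hn⟩ := h.sep x y hxy
    rw [hn]
    exact pow_le_one₀ h.τ_pos.le h.τ_lt_one.le

lemma MarkovShift.edist_le_one (h : MarkovShift m T α τ) (x y : X) : edist x y ≤ 1 := by
  rw [edist_dist]
  exact ENNReal.ofReal_le_one.2 (h.dist_le_one x y)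

lemma MarkovShift.edist_step (h : MarkovShift m T α τ) {i : ι} {x y : X} (hx : x ∈ α i)
    (hy : y ∈ α i) : edist x y = ENNReal.ofReal τ * edist (T x) (T y) := by
  rw [edist_dist, edist_dist, ← ENNReal.ofReal_mul h.τ_pos.le, h.expand i x hx y hy,
    mul_inv_cancel_left₀ h.τ_pos.ne']

lemma cylE_maps (a : Set X) (l : List ι) : ∀ x ∈ cylE T α a l, T^[l.length] x ∈ a := by
  induction l with
  | nil => intro x hx; exact hx
  | cons i l ih => intro x hx; exact ih _ hx.2

lemma MarkovShift.cyl_edist (h : MarkovShift m T α τ) (a : Set X) (l : List ι) :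
    ∀ x ∈ cylE T α a l, ∀ y ∈ cylE T α a l,
    edist x y = ENNReal.ofReal τ ^ l.length * edist (T^[l.length] x) (T^[l.length] y) := by
  induction l with
  | nil => intro x _ y _; simp
  | cons i l ih =>
    intro x hx y hy
    rw [h.edist_step hx.1 hy.1, ih _ hx.2 _ hy.2, List.length_cons, pow_succ',
      mul_assoc, Function.iterate_succ_apply, Function.iterate_succ_apply]

lemma MarkovShift.cyl_edist_le (h : MarkovShift m T α τ) (a : Set X) (l : List ι)
    (x : X) (hx : x ∈ cylE T α a l) (y : X) (hy : y ∈ cylE T α a l) :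
    edist x y ≤ ENNReal.ofReal τ ^ l.length := by
  rw [h.cyl_edist a l x hx y hy]
  exact mul_le_of_le_one_right' (h.edist_le_one _ _)

lemma MarkovShift.cyl_dist_le (h : MarkovShift m T α τ) (a : Set X) (l : List ι)
    (x : X) (hx : x ∈ cylE T α a l) (y : X) (hy : y ∈ cylE T α a l) :
    dist x y ≤ τ ^ l.length := by
  have := h.cyl_edist_le a l x hx y hy
  rw [edist_dist, ← ENNReal.ofReal_pow h.τ_pos.le] at this
  exact (ENNReal.ofReal_le_ofReal_iff (pow_nonneg h.τ_pos.le _)).1 this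

lemma MarkovShift.cyl_meas (h : MarkovShift m T α τ) {a : Set X} (ha : MeasurableSet a)
    (l : List ι) : MeasurableSet (cylE T α a l) := by
  induction l with
  | nil => exact ha
  | cons i l ih => exact (h.meas i).inter (h.measT ih)

lemma MarkovShift.eq_of_mem (h : MarkovShift m T α τ) {i j : ι} {x : X} (hi : x ∈ α i)
    (hj : x ∈ α j) : i = j := by
  by_contra hne
  exact Set.disjoint_left.1 (h.disj hne) hi hj

/-- cylinders are nested or disjoint -/
lemma MarkovShift.cyl_nested (h : MarkovShift m T α τ) (i0 : ι) (l' : List ι) :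
    ∀ l : List ι, l'.length ≤ l.length → ∀ x, x ∈ cylE T α (α i0) l → x ∈ cylE T α (α i0) l' →
      cylE T α (α i0) l ⊆ cylE T α (α i0) l' := by
  induction l' with
  | nil =>
    intro l _ x hx hx'
    cases l with
    | nil => exact subset_rfl
    | cons i l =>
      have := h.eq_of_mem hx.1 hx'
      subst this
      exact Set.inter_subset_left
  | cons i' l' ih =>
    intro l hl x hx hx'
    cases l with
    | nil => simp at hl
    | cons i l =>
      have := h.eq_of_mem hx.1 hx'.1
      subst this
      intro y hy
      exact ⟨hy.1, ih l (by simpa using hl) _ hx.2 hx'.2 hy.2⟩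

lemma MarkovShift.cyl_eq (h : MarkovShift m T α τ) (a : Set X) (l' : List ι) :
    ∀ l : List ι, l'.length = l.length → ∀ x, x ∈ cylE T α a l → x ∈ cylE T α a l' →
      l = l' := by
  induction l' with
  | nil => intro l hl x _ _; exact List.length_eq_zero_iff.1 hl.symm
  | cons i' l' ih =>
    intro l hl x hx hx'
    cases l with
    | nil => simp at hl
    | cons i l =>
      have := h.eq_of_mem hx.1 hx'.1
      subst this
      rw [ih l (by simpa using hl) _ hx.2 hx'.2]

/-- every point staying in the partition and with `T^n x ∈ a` lies in a cylinder. -/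
lemma exists_cyl (a : Set X) (n : ℕ) : ∀ x : X, (∀ k, ∃ i, T^[k] x ∈ α i) → T^[n] x ∈ a →
    ∃ l : List ι, l.length = n ∧ x ∈ cylE T α a l := by
  induction n with
  | zero => intro x _ hx; exact ⟨[], rfl, hx⟩
  | succ n ih =>
    intro x h0 hx
    obtain ⟨l, hl, hxl⟩ := ih (T x) (fun k => h0 (k + 1)) hx
    obtain ⟨i, hi⟩ := h0 0
    exact ⟨i :: l, by simp [hl], hi, hxl⟩

lemma null_orbit (hpres : MeasurePreserving T m m) {Ω : Set X} (hΩ : m Ωᶜ = 0) :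
    m {x | ∀ k, T^[k] x ∈ Ω}ᶜ = 0 := by
  have : {x | ∀ k, T^[k] x ∈ Ω}ᶜ = ⋃ k, T^[k] ⁻¹' Ωᶜ := by
    ext x; simp
  rw [this, measure_iUnion_null_iff]
  intro k
  exact (hpres.iterate k).quasiMeasurePreserving.preimage_null hΩ

/-- one-step distortion -/
lemma MarkovShift.dist_step (h : MarkovShift m T α τ) [IsFiniteMeasure m] : ∃ C : ℝ, 0 < C ∧
    ∀ i, ∀ B : Set X, B ⊆ α i → MeasurableSet B → ∀ δ : ℝ, 0 ≤ δ →
    (∀ x ∈ B, ∀ y ∈ B, dist (T x) (T y) ≤ δ) → ∀ s ⊆ B,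
    m (T '' s) * m B ≤ ENNReal.ofReal (1 + C * δ) * m s * m (T '' B) := by
  obtain ⟨g, gpos, hg, C, Cpos, hC⟩ := h.distortion
  refine ⟨C, Cpos, ?_⟩
  intro i B hB hBm δ hδ hd s hs
  have key : ∀ x ∈ B, ∀ y ∈ B, ENNReal.ofReal (g x)⁻¹ ≤
      ENNReal.ofReal (1 + C * δ) * ENNReal.ofReal (g y)⁻¹ := by
    intro x hx y hy
    rw [← ENNReal.ofReal_mul (by positivity)]
    apply ENNReal.ofReal_le_ofReal
    have h1 := hC i y (hB hy) x (hB hx)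
    have h2 : C * dist (T y) (T x) ≤ C * δ := by gcongr; exact hd y hy x hx
    have h3 : g y / g x ≤ 1 + C * δ := by
      have := neg_abs_le (1 - g y / g x)
      linarith
    have hgx := gpos x
    have hgy := gpos y
    rw [div_le_iff₀ hgx] at h3
    rw [inv_eq_one_div, ← div_eq_mul_inv, div_le_div_iff₀ hgx hgy]
    linarith
  set s' := toMeasurable m s ∩ B with hs'
  have hs'm : MeasurableSet s' := (measurableSet_toMeasurable m s).inter hBm
  have hss' : s ⊆ s' := fun x hx => ⟨subset_toMeasurable m s hx, hs hx⟩
  have hms : m s' ≤ m s := by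
    rw [← measure_toMeasurable s]
    exact measure_mono Set.inter_subset_left
  have h1 : ∀ y ∈ B, m (T '' s) ≤ ENNReal.ofReal (1 + C * δ) * m s * ENNReal.ofReal (g y)⁻¹ := by
    intro y hy
    calc m (T '' s) ≤ m (T '' s') := measure_mono (Set.image_mono hss')
      _ = ∫⁻ x in s', ENNReal.ofReal (g x)⁻¹ ∂m :=
          hg i s' (Set.inter_subset_right.trans hB) hs'm
      _ ≤ ∫⁻ x in s', ENNReal.ofReal (1 + C * δ) * ENNReal.ofReal (g y)⁻¹ ∂m :=
          setLIntegral_mono' hs'm (fun x hx => key x hx.2 y hy)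
      _ = ENNReal.ofReal (1 + C * δ) * ENNReal.ofReal (g y)⁻¹ * m s' := setLIntegral_const _ _
      _ ≤ ENNReal.ofReal (1 + C * δ) * ENNReal.ofReal (g y)⁻¹ * m s := by gcongr
      _ = _ := by ring
  calc m (T '' s) * m B = ∫⁻ _ in B, m (T '' s) ∂m := (setLIntegral_const _ _).symm
    _ ≤ ∫⁻ y in B, ENNReal.ofReal (1 + C * δ) * m s * ENNReal.ofReal (g y)⁻¹ ∂m :=
        setLIntegral_mono' hBm h1
    _ = ENNReal.ofReal (1 + C * δ) * m s * ∫⁻ y in B, ENNReal.ofReal (g y)⁻¹ ∂m :=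
        lintegral_const_mul' _ _ (ENNReal.mul_ne_top ENNReal.ofReal_ne_top (measure_ne_top _ _))
    _ = _ := by rw [hg i B hB hBm]

/-- distortion along cylinders -/
lemma MarkovShift.dist_cyl (h : MarkovShift m T α τ) [IsFiniteMeasure m]
    (hpres : MeasurePreserving T m m) : ∃ D : ℝ≥0∞, D ≠ ⊤ ∧
    ∀ a : Set X, MeasurableSet a → ∀ l : List ι, ∀ s ⊆ cylE T α a l,
    m (T^[l.length] '' s) * m (cylE T α a l) ≤ D * m s * m a := by
  obtain ⟨C, Cpos, hC⟩ := h.dist_step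
  refine ⟨ENNReal.ofReal (Real.exp (C * (1 - τ)⁻¹)), ENNReal.ofReal_ne_top, ?_⟩
  intro a ha
  have main : ∀ l : List ι, ∀ s ⊆ cylE T α a l,
      m (T^[l.length] '' s) * m (cylE T α a l) ≤
        ENNReal.ofReal (Real.exp (C * ∑ k ∈ Finset.range l.length, τ ^ k)) * m s * m a := by
    intro l
    induction l with
    | nil => intro s hs; simp [cylE]
    | cons i l ih =>
      intro s hs
      set B := cylE T α a (i :: l) with hB
      set B' := cylE T α a l with hB'
      have hTB : T '' B ⊆ B' := by
        rintro _ ⟨x, hx, rfl⟩; exact hx.2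
      by_cases h0 : m B' = 0
      · have : m B = 0 :=
          measure_mono_null Set.inter_subset_right (hpres.quasiMeasurePreserving.preimage_null h0)
        simp [this]
      have h1 := ih (T '' s) ((Set.image_mono hs).trans hTB)
      have h2 := hC i B Set.inter_subset_left (h.cyl_meas ha (i :: l)) (τ ^ l.length)
        (pow_nonneg h.τ_pos.le _)
        (fun x hx y hy => h.cyl_dist_le a l _ hx.2 _ hy.2) s hs
      have himg : T^[(i :: l).length] '' s = T^[l.length] '' (T '' s) := by
        rw [List.length_cons, Function.iterate_succ, Set.image_comp]
      rw [himg]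
      set E := ENNReal.ofReal (Real.exp (C * ∑ k ∈ Finset.range l.length, τ ^ k)) with hE
      have hE2 : E * ENNReal.ofReal (1 + C * τ ^ l.length) ≤
          ENNReal.ofReal (Real.exp (C * ∑ k ∈ Finset.range (i :: l).length, τ ^ k)) := by
        rw [hE, ← ENNReal.ofReal_mul (Real.exp_pos _).le]
        apply ENNReal.ofReal_le_ofReal
        rw [List.length_cons, Finset.sum_range_succ, mul_add C, Real.exp_add]
        gcongr
        rw [add_comm]
        exact Real.add_one_le_exp _
      refine (ENNReal.mul_le_mul_iff_left h0 (measure_ne_top m B')).1 ?_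
      calc m (T^[l.length] '' (T '' s)) * m B * m B'
          = (m (T^[l.length] '' (T '' s)) * m B') * m B := by ring
        _ ≤ (E * m (T '' s) * m a) * m B := by gcongr
        _ = E * m a * (m (T '' s) * m B) := by ring
        _ ≤ E * m a * (ENNReal.ofReal (1 + C * τ ^ l.length) * m s * m (T '' B)) := by gcongr
        _ ≤ E * m a * (ENNReal.ofReal (1 + C * τ ^ l.length) * m s * m B') := by gcongr
        _ = (E * ENNReal.ofReal (1 + C * τ ^ l.length)) * m s * m a * m B' := by ring
        _ ≤ _ := by gcongr
  intro l s hs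
  refine (main l s hs).trans ?_
  gcongr
  rw [← tsum_geometric_of_lt_one h.τ_pos.le h.τ_lt_one]
  exact (summable_geometric_of_lt_one h.τ_pos.le h.τ_lt_one).sum_le_tsum _
    (fun _ _ => pow_nonneg h.τ_pos.le _)

lemma cyl_sub (i0 : ι) (l : List ι) : ∃ j, cylE T α (α i0) l ⊆ α j := by
  cases l with
  | nil => exact ⟨i0, subset_rfl⟩
  | cons i l => exact ⟨i, Set.inter_subset_left⟩

/-- full images -/
lemma MarkovShift.full_image (h : MarkovShift m T α τ) [IsFiniteMeasure m]
    (hpres : MeasurePreserving T m m) (i0 : ι) (l : List ι) :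
    m (cylE T α (α i0) l) ≠ 0 → m (α i0 \ T^[l.length] '' cylE T α (α i0) l) = 0 := by
  obtain ⟨D, hD, hdist⟩ := h.dist_cyl hpres
  induction l with
  | nil => intro _; simp [cylE]
  | cons i l ih =>
    intro hB0
    set B := cylE T α (α i0) (i :: l) with hB
    set B' := cylE T α (α i0) l with hB'
    have hB'0 : m B' ≠ 0 := fun h0 => hB0
      (measure_mono_null Set.inter_subset_right (hpres.quasiMeasurePreserving.preimage_null h0))
    have hTB0 : m (T '' B) ≠ 0 := fun h0 => hB0
      (measure_mono_null (Set.subset_preimage_image T B)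
        (hpres.quasiMeasurePreserving.preimage_null h0))
    have hTB : T '' B = T '' α i ∩ B' := by
      ext y; constructor
      · rintro ⟨x, hx, rfl⟩; exact ⟨⟨x, hx.1, rfl⟩, hx.2⟩
      · rintro ⟨⟨x, hx, rfl⟩, hy⟩; exact ⟨x, ⟨hx, hy⟩, rfl⟩
    obtain ⟨j, hj⟩ := cyl_sub (T := T) (α := α) i0 l
    obtain ⟨S, hS⟩ := h.markov i
    have hjS : j ∈ S := by
      by_contra hjS
      apply hTB0
      refine measure_mono_null ?_ hS
      rw [hTB]
      rintro y ⟨hy1, hy2⟩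
      refine Or.inl ⟨hy1, ?_⟩
      simp only [Set.mem_iUnion, not_exists]
      intro k hk hyk
      exact hjS (h.eq_of_mem hyk (hj hy2) ▸ hk)
    have hnull : m (B' \ T '' B) = 0 := by
      refine measure_mono_null ?_ hS
      rw [hTB]
      rintro y ⟨hy1, hy2⟩
      refine Or.inr ⟨?_, fun hy3 => hy2 ⟨hy3, hy1⟩⟩
      simp only [Set.mem_iUnion]
      exact ⟨j, hjS, hj hy1⟩
    have hnull2 : m (T^[l.length] '' (B' \ T '' B)) = 0 := by
      have := hdist (α i0) (h.meas i0) l (B' \ T '' B) Set.sdiff_subset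
      rw [hnull, mul_zero, zero_mul] at this
      exact (mul_eq_zero.1 (le_antisymm this bot_le)).resolve_right hB'0
    refine measure_mono_null ?_ (measure_union_null (ih hB'0) hnull2)
    rintro y ⟨hy, hny⟩
    by_cases hy2 : y ∈ T^[l.length] '' B'
    · right
      obtain ⟨z, hz, rfl⟩ := hy2
      refine ⟨z, ⟨hz, ?_⟩, rfl⟩
      rintro ⟨x, hx, rfl⟩
      exact hny ⟨x, hx, rfl⟩
    · exact Or.inl ⟨hy, hy2⟩

end basics

section core

variable [MetricSpace X] [MeasurableSpace X] {m : Measure X} {T : X → X} {α : ι → Set X} {τ : ℝ}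

lemma MarkovShift.cover_cyl [BorelSpace X] [IsFiniteMeasure m] (h : MarkovShift m T α τ) (i0 : ι)
    (fam0 : Set (List ι)) {A : Set X} (hA : MeasurableSet A) (hA0 : m A ≠ 0)
    (hfreq : ∀ x ∈ A, ∃ᶠ n in atTop, ∃ l ∈ fam0, l.length = n ∧ x ∈ cylE T α (α i0) l)
    {ε : ℝ≥0∞} (hε : ε ≠ 0) :
    ∃ l ∈ fam0, m (cylE T α (α i0) l) ≠ 0 ∧
      m (cylE T α (α i0) l \ A) ≤ ε * m (cylE T α (α i0) l) := by
  by_contra hcon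
  push Not at hcon
  have hcon' : ∀ l ∈ fam0, ε * m (cylE T α (α i0) l) ≤ m (cylE T α (α i0) l \ A) := by
    intro l hl
    by_cases h0 : m (cylE T α (α i0) l) = 0
    · simp [h0]
    · exact (hcon l hl h0).le
  obtain ⟨U, hAU, hU, hmU⟩ := A.exists_isOpen_lt_add (measure_ne_top m A)
    (mul_ne_zero hε hA0)
  set cy := cylE T α (α i0) with hcy
  set fam : Set (List ι) := {l | l ∈ fam0 ∧ cy l ⊆ U} with hfam
  set P : Set (List ι) := {l | l ∈ fam ∧ ∀ l' ∈ fam, l'.length < l.length →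
    Disjoint (cy l) (cy l')} with hP
  have hcov : A ⊆ ⋃ l ∈ P, cy l := by
    intro x hx
    obtain ⟨r, hr, hball⟩ := Metric.isOpen_iff.1 hU x (hAU hx)
    have hex : ∃ n, ∃ l ∈ fam, l.length = n ∧ x ∈ cy l := by
      have hev : ∀ᶠ n in atTop, τ ^ n < r :=
        (tendsto_pow_atTop_nhds_zero_of_lt_one h.τ_pos.le h.τ_lt_one).eventually (gt_mem_nhds hr)
      obtain ⟨n, ⟨l, hl, hln, hxl⟩, hn⟩ := ((hfreq x hx).and_eventually hev).exists
      refine ⟨n, l, ⟨hl, ?_⟩, hln, hxl⟩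
      intro y hy
      apply hball
      rw [Metric.mem_ball]
      refine lt_of_le_of_lt (h.cyl_dist_le _ l y hy x hxl) ?_
      rwa [hln]
    classical
    obtain ⟨l, hl, hln, hxl⟩ := Nat.find_spec hex
    simp only [Set.mem_iUnion]
    refine ⟨l, ⟨hl, ?_⟩, hxl⟩
    intro l' hl' hlen
    rw [Set.disjoint_left]
    intro y hy hy'
    have := h.cyl_nested i0 l' l hlen.le y hy hy' hxl
    exact Nat.find_min hex (hln ▸ hlen) ⟨l', hl', rfl, this⟩
  have hdisj : P.PairwiseDisjoint cy := by
    intro l hl l' hl' hne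
    rcases lt_trichotomy l.length l'.length with hlt | heq | hgt
    · exact (hl'.2 l hl.1 hlt).symm
    · refine Set.disjoint_left.2 fun x hx hx' => hne ?_
      exact h.cyl_eq _ l' l heq.symm x hx hx'
    · exact hl.2 l' hl'.1 hgt
  have hcount : Countable ι := h.countable
  have hPc : P.Countable := Set.to_countable P
  have hm : ∀ l, MeasurableSet (cy l) := fun l => h.cyl_meas (h.meas i0) l
  have h1 : ε * m A ≤ m (U \ A) := by
    calc ε * m A ≤ ε * m (⋃ l ∈ P, cy l) := by gcongr
      _ = ε * ∑' l : P, m (cy l) := by rw [measure_biUnion hPc hdisj (fun l _ => hm l)]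
      _ = ∑' l : P, ε * m (cy l) := ENNReal.tsum_mul_left.symm
      _ ≤ ∑' l : P, m (cy l \ A) := ENNReal.tsum_le_tsum fun l => hcon' l l.2.1.1
      _ = m (⋃ l ∈ P, (cy l \ A)) := by
          rw [measure_biUnion hPc (fun l hl l' hl' hne => (hdisj hl hl' hne).mono
            Set.sdiff_subset Set.sdiff_subset) (fun l _ => (hm l).diff hA)]
      _ ≤ m (U \ A) := by
          apply measure_mono
          simp only [Set.iUnion_subset_iff]
          intro l hl x hx
          exact ⟨hl.1.2 hx.1, hx.2⟩
  have h2 : m U = m A + m (U \ A) := by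
    rw [← measure_union Set.disjoint_sdiff_right (hU.measurableSet.diff hA),
      Set.union_sdiff_cancel hAU]
  rw [h2] at hmU
  exact absurd (lt_of_add_lt_add_left hmU) (not_lt.2 h1)

lemma edist_sub_sub_le' [MetricSpace G] [AddCommGroup G]
    (hinv : ∀ g x y : G, dist (g + x) (g + y) = dist x y) (p q p' q' : G) :
    edist (p - q) (p' - q') ≤ edist p p' + edist q q' := by
  have hinv' : ∀ g x y : G, edist (g + x) (g + y) = edist x y := by
    intro g x y; rw [edist_dist, edist_dist, hinv]
  calc edist (p - q) (p' - q') ≤ edist (p - q) (p' - q) + edist (p' - q) (p' - q') :=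
        edist_triangle _ _ _
    _ = edist p p' + edist q q' := by
        congr 1
        · rw [← hinv' q]; congr 1 <;> abel
        · rw [← hinv' (q + q' - p'), edist_comm]; congr 1 <;> abel

lemma MarkovShift.lip_word [MetricSpace G] [AddCommGroup G] (h : MarkovShift m T α τ)
    (hinv : ∀ g x y : G, dist (g + x) (g + y) = dist x y)
    {f u : X → G} {c : ι → ℝ≥0∞} {Ω : Set X}
    (hlip : ∀ i, ∀ x ∈ Ω ∩ α i, ∀ y ∈ Ω ∩ α i, edist (f x) (f y) ≤ c i * edist x y)
    (hcob : ∀ x ∈ Ω, f x = u x - u (T x)) (a : Set X) (l : List ι) :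
    ∀ x ∈ cylE T α a l, ∀ y ∈ cylE T α a l, (∀ k, T^[k] x ∈ Ω) → (∀ k, T^[k] y ∈ Ω) →
    edist (u (T^[l.length] x)) (u (T^[l.length] y)) ≤
      edist (u x) (u y) + wt τ c l * edist (T^[l.length] x) (T^[l.length] y) := by
  induction l with
  | nil => intro x _ y _ _ _; simp [wt]
  | cons i l ih =>
    intro x hx y hy hxΩ hyΩ
    have h1 := ih (T x) hx.2 (T y) hy.2 (fun k => hxΩ (k + 1)) (fun k => hyΩ (k + 1))
    have h2 : edist (u (T x)) (u (T y)) ≤ edist (u x) (u y) + edist (f x) (f y) := by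
      have e1 : u (T x) = u x - f x := by rw [hcob x (hxΩ 0)]; abel
      have e2 : u (T y) = u y - f y := by rw [hcob y (hyΩ 0)]; abel
      rw [e1, e2]
      exact edist_sub_sub_le' hinv _ _ _ _
    have h3 := hlip i x ⟨hxΩ 0, hx.1⟩ y ⟨hyΩ 0, hy.1⟩
    rw [h.cyl_edist a (i :: l) x hx y hy] at h3
    have e : ∀ z, T^[(i :: l).length] z = T^[l.length] (T z) := fun z => rfl
    rw [e, e] at *
    rw [List.length_cons] at h3
    calc _ ≤ _ := h1
      _ ≤ edist (u x) (u y) + (c i * (ENNReal.ofReal τ ^ (l.length + 1) *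
            edist (T^[l.length] (T x)) (T^[l.length] (T y)))) +
            wt τ c l * edist (T^[l.length] (T x)) (T^[l.length] (T y)) := by
          gcongr
          exact h2.trans (by gcongr)
      _ = _ := by rw [wt]; ring

/-- points which at time `n` are in `α i0`, with weight at most `K` -/
def goodAt (T : X → X) (α : ι → Set X) (τ : ℝ) (c : ι → ℝ≥0∞) (i0 : ι) (K : ℝ≥0∞) (n : ℕ) :
    Set X := ⋃ l ∈ {l : List ι | l.length = n ∧ wt τ c l ≤ K}, cylE T α (α i0) l

lemma MarkovShift.goodAt_meas (h : MarkovShift m T α τ) (c : ι → ℝ≥0∞) (i0 : ι) (K : ℝ≥0∞)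
    (n : ℕ) : MeasurableSet (goodAt T α τ c i0 K n) := by
  have hcount : Countable ι := h.countable
  exact MeasurableSet.biUnion (Set.to_countable _) fun l _ => h.cyl_meas (h.meas i0) l

lemma MarkovShift.core [MetricSpace G] [AddCommGroup G] [MeasurableSpace G] [BorelSpace G]
    [BorelSpace X] [IsFiniteMeasure m] (h : MarkovShift m T α τ)
    (hpres : MeasurePreserving T m m)
    (hinv : ∀ g x y : G, dist (g + x) (g + y) = dist x y)
    {f u : X → G} (hu : Measurable u) {c : ι → ℝ≥0∞} {Ω : Set X} (hΩ : m Ωᶜ = 0)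
    (hlip : ∀ i, ∀ x ∈ Ω ∩ α i, ∀ y ∈ Ω ∩ α i, edist (f x) (f y) ≤ c i * edist x y)
    (hcob : ∀ x ∈ Ω, f x = u x - u (T x))
    (hsep : ∀ L : Set X, MeasurableSet L → m L ≠ 0 → ∀ ε : ℝ, 0 < ε →
      ∃ g : G, m (L ∩ u ⁻¹' Metric.ball g ε) ≠ 0)
    (i0 : ι) (K : ℝ≥0∞) (hL : m (limsup (goodAt T α τ c i0 K) atTop) ≠ 0) :
    ∃ R ⊆ α i0, m (α i0 \ R) = 0 ∧ ∀ x ∈ R, ∀ y ∈ R, edist (u x) (u y) ≤ K * edist x y := by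
  obtain ⟨D, hD, hdist⟩ := h.dist_cyl hpres
  have hLm : MeasurableSet (limsup (goodAt T α τ c i0 K) atTop) :=
    MeasurableSet.measurableSet_limsup fun n => h.goodAt_meas c i0 K n
  set X1 : Set X := {x | ∀ k, T^[k] x ∈ Ω} with hX1
  have hX1n : m X1ᶜ = 0 := null_orbit hpres hΩ
  have step : ∀ ε : ℝ, 0 < ε → ∃ R ⊆ α i0, m (α i0 \ R) ≤ D * ENNReal.ofReal ε * m (α i0) ∧
      ∀ x ∈ R, ∀ y ∈ R, edist (u x) (u y) ≤ 2 * ENNReal.ofReal ε + K * edist x y := by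
    intro ε hε
    obtain ⟨g, hg⟩ := hsep _ hLm hL ε hε
    obtain ⟨l, hl, hl0, hlA⟩ := h.cover_cyl i0 {l | wt τ c l ≤ K}
      (hLm.inter (hu measurableSet_ball)) hg (by
        intro x hx
        have := hx.1
        rw [mem_limsup_iff_frequently_mem] at this
        refine this.mono fun n hn => ?_
        simp only [goodAt, Set.mem_iUnion] at hn
        obtain ⟨l, ⟨hl1, hl2⟩, hl3⟩ := hn
        exact ⟨l, hl2, hl1, hl3⟩) (ε := ENNReal.ofReal ε) (by simpa using hε)
    set B := cylE T α (α i0) l with hB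
    set S := B ∩ X1 ∩ u ⁻¹' Metric.ball g ε with hS
    refine ⟨T^[l.length] '' S, ?_, ?_, ?_⟩
    · rintro _ ⟨x, hx, rfl⟩
      exact cylE_maps _ l x hx.1.1
    · have h1 : m (B \ S) ≤ ENNReal.ofReal ε * m B := by
        refine le_trans ?_ hlA
        calc m (B \ S) ≤ m ((B \ (limsup (goodAt T α τ c i0 K) atTop ∩
              u ⁻¹' Metric.ball g ε)) ∪ X1ᶜ) := by
              apply measure_mono
              rintro x ⟨hx, hnx⟩
              by_cases hx1 : x ∈ X1
              · exact Or.inl ⟨hx, fun hh => hnx ⟨⟨hx, hx1⟩, hh.2⟩⟩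
              · exact Or.inr hx1
          _ ≤ _ := (measure_union_le _ _).trans (by rw [hX1n, add_zero])
      have h2 := hdist (α i0) (h.meas i0) l (B \ S) Set.sdiff_subset
      have h3 : m (T^[l.length] '' (B \ S)) ≤ D * ENNReal.ofReal ε * m (α i0) := by
        refine (ENNReal.mul_le_mul_iff_left hl0 (measure_ne_top m B)).1 ?_
        calc _ ≤ _ := h2
          _ ≤ D * (ENNReal.ofReal ε * m B) * m (α i0) := by gcongr
          _ = _ := by ring
      calc m (α i0 \ T^[l.length] '' S) ≤ m ((α i0 \ T^[l.length] '' B) ∪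
            T^[l.length] '' (B \ S)) := by
            apply measure_mono
            rintro y ⟨hy, hny⟩
            by_cases hy2 : y ∈ T^[l.length] '' B
            · right
              obtain ⟨z, hz, rfl⟩ := hy2
              exact ⟨z, ⟨hz, fun hzS => hny ⟨z, hzS, rfl⟩⟩, rfl⟩
            · exact Or.inl ⟨hy, hy2⟩
        _ ≤ _ := (measure_union_le _ _).trans (by rw [h.full_image hpres i0 l hl0, zero_add])
        _ ≤ _ := h3
    · rintro _ ⟨x, hx, rfl⟩ _ ⟨y, hy, rfl⟩
      refine (h.lip_word hinv hlip hcob _ l x hx.1.1 y hy.1.1 hx.1.2 hy.1.2).trans ?_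
      gcongr
      · have e1 : edist (u x) g ≤ ENNReal.ofReal ε := by
          rw [edist_dist]; exact ENNReal.ofReal_le_ofReal (le_of_lt hx.2)
        have e2 : edist (u y) g ≤ ENNReal.ofReal ε := by
          rw [edist_dist]; exact ENNReal.ofReal_le_ofReal (le_of_lt hy.2)
        calc edist (u x) (u y) ≤ edist (u x) g + edist (u y) g := edist_triangle_right _ _ _
          _ ≤ ENNReal.ofReal ε + ENNReal.ofReal ε := add_le_add e1 e2
          _ = _ := (two_mul _).symm
      · exact hl
  choose R hRs hRm hR using fun n : ℕ => step ((1 / 2) ^ n) (by positivity)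
  have hsum : ∑' n, m (α i0 \ R n) ≠ ⊤ := by
    refine ne_top_of_le_ne_top ?_ (ENNReal.tsum_le_tsum hRm)
    rw [ENNReal.tsum_mul_right, ENNReal.tsum_mul_left]
    refine ENNReal.mul_ne_top (ENNReal.mul_ne_top hD ?_) (measure_ne_top _ _)
    rw [← ENNReal.ofReal_tsum_of_nonneg (fun n => by positivity) summable_geometric_two]
    exact ENNReal.ofReal_ne_top
  have hlim := measure_limsup_atTop_eq_zero hsum
  refine ⟨{x | x ∈ α i0 ∧ ∀ᶠ n in atTop, x ∈ R n}, fun x hx => hx.1, ?_, ?_⟩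
  · refine measure_mono_null ?_ hlim
    rintro x ⟨hx, hnx⟩
    rw [mem_limsup_iff_frequently_mem]
    have : ¬ ∀ᶠ n in atTop, x ∈ R n := fun hh => hnx ⟨hx, hh⟩
    rw [not_eventually] at this
    exact this.mono fun n hn => ⟨hx, hn⟩
  · intro x hx y hy
    have ht : Tendsto (fun n : ℕ => 2 * ENNReal.ofReal ((1 / 2) ^ n) + K * edist x y) atTop
        (nhds (2 * ENNReal.ofReal 0 + K * edist x y)) := by
      refine Tendsto.add_const _ (ENNReal.Tendsto.const_mul (ENNReal.tendsto_ofReal ?_) (Or.inr (by simp)))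
      exact tendsto_pow_atTop_nhds_zero_of_lt_one (by norm_num) (by norm_num)
    have := ge_of_tendsto ht ((hx.2.and hy.2).mono fun n hn => hR n x hn.1 y hn.2)
    simpa using this

lemma tendsto_of_limsup_null [IsFiniteMeasure m] {L : ℕ → Set X} (hL : ∀ n, MeasurableSet (L n))
    (h0 : m (limsup L atTop) = 0) : Tendsto (fun n => m (L n)) atTop (nhds 0) := by
  have hanti : Antitone fun N => ⋃ n ≥ N, L n := by
    intro N M hNM x hx
    simp only [Set.mem_iUnion] at hx ⊢
    obtain ⟨n, hn, hx⟩ := hx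
    exact ⟨n, hNM.trans hn, hx⟩
  have h1 := tendsto_measure_iInter_atTop (μ := m) (s := fun N => ⋃ n ≥ N, L n)
    (fun N => (MeasurableSet.iUnion fun n => MeasurableSet.iUnion fun _ => hL n).nullMeasurableSet)
    hanti ⟨0, measure_ne_top _ _⟩
  have h2 : (⋂ N, ⋃ n ≥ N, L n) = limsup L atTop := by
    rw [limsup_eq_iInf_iSup_of_nat]; rfl
  rw [h2, h0] at h1
  refine tendsto_of_tendsto_of_tendsto_of_le_of_le tendsto_const_nhds h1 (fun _ => bot_le) ?_
  intro n
  apply measure_mono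
  intro x hx
  simp only [Set.mem_iUnion]
  exact ⟨n, le_rfl, hx⟩

end core

section separable

variable [MetricSpace X] [MeasurableSpace X] {m : Measure X} {T : X → X} {α : ι → Set X} {τ : ℝ}

lemma MarkovShift.null_X0 (h : MarkovShift m T α τ) (hpres : MeasurePreserving T m m) :
    m {x | ∀ k, ∃ i, T^[k] x ∈ α i}ᶜ = 0 := by
  have := null_orbit hpres h.cover
  simpa only [Set.mem_iUnion] using this

lemma wt_zero (τ : ℝ) (l : List ι) : wt τ (fun _ => 0) l = 0 := by
  induction l with
  | nil => rfl
  | cons i l ih => simp [wt, ih]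

lemma MarkovShift.zero_one [BorelSpace X] [IsFiniteMeasure m] (h : MarkovShift m T α τ)
    (hpres : MeasurePreserving T m m) {S : Set X} (hS : MeasurableSet S)
    {Ω : Set X} (hΩ : m Ωᶜ = 0) (hinv : ∀ x ∈ Ω, (T x ∈ S ↔ x ∈ S)) (i : ι) :
    m (α i ∩ S) = 0 ∨ m (α i \ S) = 0 := by
  classical
  set u : X → ℤ := S.indicator (fun _ => 1) with hu
  have hum : Measurable u := measurable_const.indicator hS
  have hlim : m (limsup (goodAt T α τ (fun _ => 0) i 0) atTop) ≠ 0 := by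
    intro h0
    have ht := tendsto_of_limsup_null (fun n => h.goodAt_meas (fun _ => 0) i 0 n) h0
    have hle : ∀ n, m (α i) ≤ m (goodAt T α τ (fun _ => 0) i 0 n) := by
      intro n
      rw [← (hpres.iterate n).measure_preimage (h.meas i).nullMeasurableSet]
      calc m (T^[n] ⁻¹' α i) ≤ m (goodAt T α τ (fun _ => 0) i 0 n ∪
            {x | ∀ k, ∃ i, T^[k] x ∈ α i}ᶜ) := by
            apply measure_mono
            intro x hx
            by_cases hx0 : ∀ k, ∃ i, T^[k] x ∈ α i
            · left
              obtain ⟨l, hl, hxl⟩ := exists_cyl (α i) n x hx0 hx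
              simp only [goodAt, Set.mem_iUnion]
              exact ⟨l, ⟨hl, (wt_zero τ l).le⟩, hxl⟩
            · exact Or.inr hx0
        _ ≤ _ := (measure_union_le _ _).trans (by rw [h.null_X0 hpres, add_zero])
    have := ge_of_tendsto' ht hle
    exact absurd (h.pos i) (not_lt.2 this)
  obtain ⟨R, hR, hRm, hRl⟩ := h.core (G := ℤ) hpres
    (fun g x y => by simp) (f := fun _ => 0) (u := u) hum
    (c := fun _ => 0) hΩ (by intro i x _ y _; simp)
    (by
      intro x hx
      have := hinv x hx
      by_cases hxS : x ∈ S
      · have h2 := this.2 hxS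
        simp [hu, hxS, h2]
      · have h2 : T x ∉ S := fun hh => hxS (this.1 hh)
        simp [hu, hxS, h2])
    (by
      intro L hL hL0 ε hε
      by_contra hcon
      push Not at hcon
      apply hL0
      refine measure_mono_null ?_ (measure_iUnion_null hcon)
      intro x hx
      simp only [Set.mem_iUnion]
      exact ⟨u x, hx, Metric.mem_ball_self hε⟩) i 0 hlim
  by_cases hne : ∃ x ∈ R, x ∈ S
  · right
    obtain ⟨x, hx, hxS⟩ := hne
    refine measure_mono_null ?_ hRm
    rintro y ⟨hy, hyS⟩
    refine ⟨hy, fun hyR => ?_⟩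
    have := hRl x hx y hyR
    rw [zero_mul, nonpos_iff_eq_zero, edist_eq_zero] at this
    simp [hu, hxS, hyS] at this
  · left
    push Not at hne
    refine measure_mono_null ?_ hRm
    rintro y ⟨hy, hyS⟩
    exact ⟨hy, fun hyR => hne y hyR hyS⟩

/-- points with the same itinerary agree -/
lemma MarkovShift.itin_inj (h : MarkovShift m T α τ) {x y : X}
    (hxy : ∀ k, ∃ i, T^[k] x ∈ α i ∧ T^[k] y ∈ α i) : x = y := by
  have key : ∀ n : ℕ, ∀ x y : X, (∀ k, ∃ i, T^[k] x ∈ α i ∧ T^[k] y ∈ α i) →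
      edist x y ≤ ENNReal.ofReal τ ^ n := by
    intro n
    induction n with
    | zero => intro x y _; simpa using h.edist_le_one x y
    | succ n ih =>
      intro x y hxy
      obtain ⟨i, hx, hy⟩ := hxy 0
      rw [h.edist_step (x := x) (y := y) hx hy, pow_succ']
      gcongr
      exact ih _ _ fun k => hxy (k + 1)
  have ht : Tendsto (fun n : ℕ => ENNReal.ofReal τ ^ n) atTop (nhds 0) :=
    ENNReal.tendsto_pow_atTop_nhds_zero_of_lt_one (by
      rw [← ENNReal.ofReal_one]
      exact (ENNReal.ofReal_lt_ofReal_iff one_pos).2 h.τ_lt_one)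
  have := ge_of_tendsto' ht fun n => key n x y hxy
  exact edist_eq_zero.1 (le_antisymm this bot_le)

lemma MarkovShift.sep_X0 (h : MarkovShift m T α τ) :
    TopologicalSpace.IsSeparable {x | ∀ k, ∃ i, T^[k] x ∈ α i} := by
  classical
  have hcount : Countable ι := h.countable
  by_cases hne : Nonempty X
  swap
  · rw [not_nonempty_iff] at hne
    rw [Set.eq_empty_of_isEmpty {x : X | ∀ k, ∃ i, T^[k] x ∈ α i}]
    exact Set.countable_empty.isSeparable
  let p : List ι → X := fun l =>
    if hh : (cylE T α Set.univ l).Nonempty then hh.some else Classical.choice hne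
  refine ⟨Set.range p, Set.countable_range p, ?_⟩
  intro x hx
  rw [Metric.mem_closure_range_iff]
  intro ε hε
  obtain ⟨n, hn⟩ := exists_pow_lt_of_lt_one hε h.τ_lt_one
  obtain ⟨l, hl, hxl⟩ := exists_cyl Set.univ n x hx trivial
  refine ⟨l, ?_⟩
  have hh : (cylE T α Set.univ l).Nonempty := ⟨x, hxl⟩
  have : p l ∈ cylE T α Set.univ l := by
    simp only [p, dif_pos hh]
    exact hh.some_mem
  refine lt_of_le_of_lt (h.cyl_dist_le Set.univ l x hxl _ this) ?_
  rwa [hl]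

lemma topAddGroup_of_inv [MetricSpace G] [AddCommGroup G]
    (hinv : ∀ g x y : G, dist (g + x) (g + y) = dist x y) : IsTopologicalAddGroup G := by
  have hinv' : ∀ g x y : G, edist (g + x) (g + y) = edist x y := by
    intro g x y; rw [edist_dist, edist_dist, hinv]
  have hneg : ∀ x y : G, edist (-x) (-y) = edist x y := by
    intro x y
    rw [← hinv' (x + y), edist_comm]; congr 1 <;> abel
  have c2 : Continuous fun x : G => -x :=
    (Isometry.continuous (fun x y => hneg x y))
  have c1 : Continuous fun p : G × G => p.1 + p.2 := by
    have : LipschitzWith 2 fun p : G × G => p.1 + p.2 := by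
      intro p q
      have := edist_sub_sub_le' hinv p.1 (-p.2) q.1 (-q.2)
      rw [hneg, sub_neg_eq_add, sub_neg_eq_add] at this
      refine this.trans ?_
      rw [Prod.edist_eq]
      calc _ ≤ max (edist p.1 q.1) (edist p.2 q.2) + max (edist p.1 q.1) (edist p.2 q.2) :=
            add_le_add (le_max_left _ _) (le_max_right _ _)
        _ = _ := by rw [← two_mul]; rfl
    exact this.continuous
  exact { continuous_add := c1, continuous_neg := c2 }

lemma MarkovShift.sep_range [MetricSpace G] [AddCommGroup G] [MeasurableSpace G] [BorelSpace G]
    [LocallyCompactSpace G]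
    [BorelSpace X] [IsFiniteMeasure m] (h : MarkovShift m T α τ)
    (hpres : MeasurePreserving T m m)
    (hinv : ∀ g x y : G, dist (g + x) (g + y) = dist x y)
    {f u : X → G} (hu : Measurable u) {c : ι → ℝ≥0∞} (hc : ∀ i, c i ≠ ⊤)
    {Ω : Set X} (hΩ : m Ωᶜ = 0)
    (hlip : ∀ i, ∀ x ∈ Ω ∩ α i, ∀ y ∈ Ω ∩ α i, edist (f x) (f y) ≤ c i * edist x y)
    (hcob : ∀ x ∈ Ω, f x = u x - u (T x)) :
    ∀ L : Set X, MeasurableSet L → m L ≠ 0 → ∀ ε : ℝ, 0 < ε →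
      ∃ g : G, m (L ∩ u ⁻¹' Metric.ball g ε) ≠ 0 := by
  classical
  have hcount : Countable ι := h.countable
  have htg : IsTopologicalAddGroup G := topAddGroup_of_inv hinv
  set X0 : Set X := {x | ∀ k, ∃ i, T^[k] x ∈ α i} with hX0
  have hX0n : m X0ᶜ = 0 := h.null_X0 hpres
  -- the essential range of f is separable
  have hfsep : ∀ i, TopologicalSpace.IsSeparable (f '' (Ω ∩ α i ∩ X0)) := by
    intro i
    have hs : TopologicalSpace.IsSeparable (Ω ∩ α i ∩ X0) := h.sep_X0.mono Set.inter_subset_right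
    have := hs.separableSpace
    have hl : LipschitzOnWith (c i).toNNReal f (Ω ∩ α i ∩ X0) := by
      intro x hx y hy
      rw [ENNReal.coe_toNNReal (hc i)]
      exact hlip i x hx.1 y hy.1
    have := TopologicalSpace.isSeparable_range hl.continuousOn.domRestrict
    rwa [Set.range_domRestrict] at this
  have hfsep' : TopologicalSpace.IsSeparable (⋃ i, f '' (Ω ∩ α i ∩ X0)) :=
    TopologicalSpace.IsSeparable.iUnion hfsep
  obtain ⟨V, hVc, hV0⟩ := exists_compact_mem_nhds (0 : G)
  obtain ⟨Q, hQc, hQ⟩ := hfsep'.union hVc.isSeparable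
  set Λ : AddSubgroup G := AddSubgroup.closure Q with hΛ
  have hΛc : (Λ : Set G).Countable := by
    have : Countable Q := hQc
    have hfree : Countable (FreeAddGroup Q) := by
      unfold FreeAddGroup; infer_instance
    rw [hΛ, FreeAddGroup.closure_eq_range, AddMonoidHom.coe_range]
    exact Set.countable_range _
  set P : AddSubgroup G := Λ.topologicalClosure with hP
  have hPcoe : (P : Set G) = closure (Λ : Set G) := Λ.topologicalClosure_coe
  have hPsep : TopologicalSpace.IsSeparable (P : Set G) := by
    rw [hPcoe]; exact hΛc.isSeparable.closure
  have hQP : closure Q ⊆ (P : Set G) := by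
    rw [hPcoe]; exact closure_mono AddSubgroup.subset_closure
  have hPopen : IsOpen (P : Set G) := by
    apply AddSubgroup.isOpen_of_mem_nhds P (g := 0)
    exact mem_of_superset hV0 fun x hx => hQP (hQ (Or.inr hx))
  have hdisc : DiscreteTopology (G ⧸ P) := QuotientAddGroup.discreteTopology hPopen
  set w : X → G ⧸ P := fun x => (u x : G ⧸ P) with hw
  have hwm : ∀ S : Set (G ⧸ P), MeasurableSet (w ⁻¹' S) := by
    intro S
    have : IsOpen ((fun g : G => (g : G ⧸ P)) ⁻¹' S) :=
      (isOpen_discrete S).preimage QuotientAddGroup.continuous_mk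
    exact hu this.measurableSet
  have hΩ0 : m (Ω ∩ X0)ᶜ = 0 := by
    rw [Set.compl_inter]; exact measure_union_null hΩ hX0n
  have hwinv : ∀ x ∈ Ω ∩ X0, w (T x) = w x := by
    rintro x ⟨hx, hx0⟩
    obtain ⟨i, hi⟩ := hx0 0
    have hfP : f x ∈ P := hQP (hQ (Or.inl (Set.mem_iUnion.2 ⟨i, x, ⟨⟨hx, hi⟩, hx0⟩, rfl⟩)))
    rw [hcob x hx] at hfP
    refine QuotientAddGroup.eq.2 ?_
    rw [neg_add_eq_sub]; exact hfP
  -- `w` is a.e. constant on each `α i`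
  let φ : G ⧸ P → X → Prop := fun q x => x ∈ X0 ∧ w x = q
  let S : ℕ → ι → Set (G ⧸ P) := fun n j =>
    {q | ∃ hq : ∃ x, φ q x, T^[n] hq.choose ∈ α j}
  have hconst : ∀ i, ∃ q : G ⧸ P, m (α i \ w ⁻¹' {q}) = 0 := by
    intro i
    have h01 : ∀ n j, m (α i ∩ w ⁻¹' S n j) = 0 ∨ m (α i \ w ⁻¹' S n j) = 0 := by
      intro n j
      refine h.zero_one hpres (hwm (S n j)) hΩ0 ?_ i
      intro x hx
      simp only [Set.mem_preimage, hwinv x hx]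
    let N : ℕ → ι → Set X := fun n j =>
      if m (α i ∩ w ⁻¹' S n j) = 0 then α i ∩ w ⁻¹' S n j else α i \ w ⁻¹' S n j
    have hN : ∀ n j, m (N n j) = 0 := by
      intro n j
      simp only [N]
      split_ifs with h0
      · exact h0
      · exact (h01 n j).resolve_left h0
    have hbad : m (X0ᶜ ∪ ⋃ n, ⋃ j, N n j) = 0 :=
      measure_union_null hX0n (measure_iUnion_null fun n => measure_iUnion_null fun j => hN n j)
    have heq : ∀ x ∈ α i \ (X0ᶜ ∪ ⋃ n, ⋃ j, N n j), ∀ y ∈ α i \ (X0ᶜ ∪ ⋃ n, ⋃ j, N n j),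
        w x = w y := by
      intro x hx y hy
      have hx0 : x ∈ X0 := by
        by_contra hh; exact hx.2 (Or.inl hh)
      have hy0 : y ∈ X0 := by
        by_contra hh; exact hy.2 (Or.inl hh)
      have hxN : ∀ n j, x ∉ N n j := fun n j hh =>
        hx.2 (Or.inr (Set.mem_iUnion.2 ⟨n, Set.mem_iUnion.2 ⟨j, hh⟩⟩))
      have hyN : ∀ n j, y ∉ N n j := fun n j hh =>
        hy.2 (Or.inr (Set.mem_iUnion.2 ⟨n, Set.mem_iUnion.2 ⟨j, hh⟩⟩))
      have hiff : ∀ n j, w x ∈ S n j → w y ∈ S n j := by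
        intro n j hxS
        have h1 := hxN n j
        have h2 := hyN n j
        simp only [N] at h1 h2
        split_ifs at h1 h2 with h0
        · exact absurd ⟨hx.1, hxS⟩ h1
        · by_contra hyS
          exact h2 ⟨hy.1, hyS⟩
      have ex : ∃ z, φ (w x) z := ⟨x, hx0, rfl⟩
      have ey : ∃ z, φ (w y) z := ⟨y, hy0, rfl⟩
      have hsame : ex.choose = ey.choose := by
        apply h.itin_inj
        intro k
        obtain ⟨j, hj⟩ := ex.choose_spec.1 k
        obtain ⟨_, hj'⟩ := hiff k j ⟨ex, hj⟩
        exact ⟨j, hj, hj'⟩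
      rw [← ex.choose_spec.2, ← ey.choose_spec.2, hsame]
    have hne : (α i \ (X0ᶜ ∪ ⋃ n, ⋃ j, N n j)).Nonempty := by
      apply nonempty_of_measure_ne_zero (μ := m)
      rw [measure_sdiff_null hbad]
      exact (h.pos i).ne'
    obtain ⟨x, hx⟩ := hne
    refine ⟨w x, measure_mono_null ?_ hbad⟩
    rintro y ⟨hy, hny⟩
    by_contra hh
    exact hny (heq y ⟨hy, hh⟩ x hx)
  choose q hq using hconst
  choose r hr using fun i => QuotientAddGroup.mk_surjective (q i)
  have hZ : TopologicalSpace.IsSeparable (⋃ i, (fun z => r i + z) '' (P : Set G)) :=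
    TopologicalSpace.IsSeparable.iUnion fun i => hPsep.image (continuous_const.add continuous_id)
  obtain ⟨E, hEc, hE⟩ := hZ
  have hnull : m ((⋃ i, α i)ᶜ ∪ ⋃ i, (α i \ w ⁻¹' {q i})) = 0 :=
    measure_union_null h.cover (measure_iUnion_null hq)
  intro L hL hL0 ε hε
  by_contra hcon
  push Not at hcon
  apply hL0
  have hb : m (⋃ g ∈ E, L ∩ u ⁻¹' Metric.ball g ε) = 0 :=
    (measure_biUnion_null_iff hEc).2 fun g _ => hcon g
  refine measure_mono_null ?_ (measure_union_null hnull hb)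
  intro x hx
  by_cases hxn : x ∈ (⋃ i, α i)ᶜ ∪ ⋃ i, (α i \ w ⁻¹' {q i})
  · exact Or.inl hxn
  right
  have hxα : x ∈ ⋃ i, α i := by
    by_contra hh; exact hxn (Or.inl hh)
  obtain ⟨i, hi⟩ := Set.mem_iUnion.1 hxα
  have hwq : w x = q i := by
    by_contra hh
    exact hxn (Or.inr (Set.mem_iUnion.2 ⟨i, hi, hh⟩))
  have hux : u x ∈ closure E := by
    apply hE
    refine Set.mem_iUnion.2 ⟨i, -r i + u x, ?_, by simp⟩
    rw [← hr i] at hwq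
    exact QuotientAddGroup.eq.1 hwq.symm
  obtain ⟨g, hg, hd⟩ := Metric.mem_closure_iff.1 hux ε hε
  exact Set.mem_biUnion hg ⟨hx, hd⟩

end separable

section final

variable [MetricSpace X] [MeasurableSpace X] {m : Measure X} {T : X → X} {α : ι → Set X} {τ : ℝ}

/-- Weighted Birkhoff-type sums. -/
noncomputable def Hs (T : X → X) (τ : ℝ) (F : X → ℝ≥0∞) : ℕ → X → ℝ≥0∞
  | 0, _ => 0
  | n + 1, x => ENNReal.ofReal τ ^ (n + 1) * F x + Hs T τ F n (T x)

lemma Hs_meas (hT : Measurable T) {F : X → ℝ≥0∞} (hF : Measurable F) (n : ℕ) :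
    Measurable (Hs T τ F n) := by
  induction n with
  | zero => exact measurable_const
  | succ n ih => exact (hF.const_mul _).add (ih.comp hT)

lemma Hs_int (hpres : MeasurePreserving T m m) {F : X → ℝ≥0∞} (hF : Measurable F) (n : ℕ) :
    ∫⁻ x, Hs T τ F n x ∂m =
      ∑ k ∈ Finset.range n, ENNReal.ofReal τ ^ (k + 1) * ∫⁻ x, F x ∂m := by
  induction n with
  | zero => simp [Hs]
  | succ n ih =>
    have e : ∀ x, Hs T τ F (n + 1) x = ENNReal.ofReal τ ^ (n + 1) * F x + Hs T τ F n (T x) :=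
      fun x => rfl
    simp_rw [e]
    rw [lintegral_add_left (hF.const_mul _), lintegral_const_mul _ hF,
      hpres.lintegral_comp (Hs_meas hpres.measurable hF n), ih, Finset.sum_range_succ, add_comm]

lemma Hs_wt {F : X → ℝ≥0∞} {c : ι → ℝ≥0∞} (hF : ∀ i, ∀ x ∈ α i, F x = c i) (a : Set X)
    (l : List ι) : ∀ x ∈ cylE T α a l, Hs T τ F l.length x = wt τ c l := by
  induction l with
  | nil => intro x _; rfl
  | cons i l ih =>
    intro x hx
    rw [List.length_cons, Hs, wt, ih _ hx.2, hF i x hx.1]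

lemma MarkovShift.final_bound [MetricSpace G] [AddCommGroup G] [MeasurableSpace G] [BorelSpace G]
    [LocallyCompactSpace G]
    [BorelSpace X] [IsFiniteMeasure m] (h : MarkovShift m T α τ)
    (hpres : MeasurePreserving T m m)
    (hinv : ∀ g x y : G, dist (g + x) (g + y) = dist x y)
    {f u : X → G} (hu : Measurable u) {c : ι → ℝ≥0∞} (hc : ∀ i, c i ≠ ⊤)
    (hcs : ∑' i, c i * m (α i) ≠ ⊤)
    {Ω : Set X} (hΩ : m Ωᶜ = 0)
    (hlip : ∀ i, ∀ x ∈ Ω ∩ α i, ∀ y ∈ Ω ∩ α i, edist (f x) (f y) ≤ c i * edist x y)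
    (hcob : ∀ x ∈ Ω, f x = u x - u (T x)) :
    (∑' i, m (α i) * essLip m u (α i)) ≠ ⊤ := by
  classical
  have hcount : Countable ι := h.countable
  have hsep := h.sep_range hpres hinv hu hc hΩ hlip hcob
  set F : X → ℝ≥0∞ := fun x => ∑' i, (α i).indicator (fun _ => c i) x with hFdef
  have hFm : Measurable F := Measurable.ennreal_tsum fun i => measurable_const.indicator (h.meas i)
  have hFc : ∀ i, ∀ x ∈ α i, F x = c i := by
    intro i x hx
    simp only [hFdef]
    rw [tsum_eq_single i]
    · simp [hx]
    · intro j hj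
      exact Set.indicator_of_notMem (fun hxj => hj (h.eq_of_mem hxj hx)) _
  have hFint : ∫⁻ x, F x ∂m = ∑' i, c i * m (α i) := by
    simp only [hFdef]
    rw [lintegral_tsum fun i => (measurable_const.indicator (h.meas i)).aemeasurable]
    congr 1
    ext i
    rw [lintegral_indicator (h.meas i), setLIntegral_const]
  set M := ∑' i, c i * m (α i) with hM
  set t := ENNReal.ofReal τ with ht
  have ht1 : t < 1 := by
    rw [ht, ← ENNReal.ofReal_one]
    exact (ENNReal.ofReal_lt_ofReal_iff one_pos).2 h.τ_lt_one
  have hbound : ∀ n, ∫⁻ x, Hs T τ F n x ∂m ≤ (1 - t)⁻¹ * M := by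
    intro n
    rw [Hs_int hpres hFm, hFint, ← Finset.sum_mul, ← ENNReal.tsum_geometric]
    gcongr
    calc ∑ k ∈ Finset.range n, t ^ (k + 1) ≤ ∑ k ∈ Finset.range n, t ^ k := by
          refine Finset.sum_le_sum fun k _ => ?_
          exact pow_le_pow_of_le_one bot_le ht1.le (Nat.le_succ k)
      _ ≤ _ := ENNReal.sum_le_tsum _
  set I : ℕ → ι → ℝ≥0∞ := fun n i => ∫⁻ x in T^[n] ⁻¹' α i, Hs T τ F n x ∂m with hI
  have hIsum : ∀ n, ∑' i, I n i ≤ (1 - t)⁻¹ * M := by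
    intro n
    refine le_trans ?_ (hbound n)
    simp only [hI]
    rw [← lintegral_iUnion (fun i => (h.measT.iterate n) (h.meas i))
      (fun i j hij => (h.disj hij).preimage _)]
    exact setLIntegral_le_lintegral _ _
  have hliminf : ∀ i, m (α i) * essLip m u (α i) ≤ liminf (fun n => I n i) atTop := by
    intro i
    rw [mul_comm]
    refine ENNReal.mul_le_of_forall_lt fun K hK b hb => ?_
    refine (mul_le_mul_right hb.le K).trans ?_
    have hKt : K ≠ ⊤ := hK.ne_top
    have hlim : m (limsup (goodAt T α τ c i K) atTop) = 0 := by
      by_contra h0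
      obtain ⟨R, hR, hRm, hRl⟩ := h.core hpres hinv hu hΩ hlip hcob hsep i K h0
      exact absurd hK (not_lt.2 (sInf_le ⟨R, hR, hRm, hRl⟩))
    have htend := tendsto_of_limsup_null (fun n => h.goodAt_meas c i K n) hlim
    have htend2 : Tendsto (fun n => K * (m (α i) - m (goodAt T α τ c i K n))) atTop
        (nhds (K * (m (α i) - 0))) :=
      ENNReal.Tendsto.const_mul
        (ENNReal.Tendsto.sub tendsto_const_nhds htend (Or.inl (measure_ne_top _ _)))
        (Or.inr hKt)
    rw [tsub_zero] at htend2
    rw [← htend2.liminf_eq]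
    refine liminf_le_liminf (Eventually.of_forall fun n => ?_)
    set Y := T^[n] ⁻¹' α i \ goodAt T α τ c i K n with hY
    have hYm : MeasurableSet Y := ((h.measT.iterate n) (h.meas i)).diff (h.goodAt_meas c i K n)
    calc K * (m (α i) - m (goodAt T α τ c i K n)) ≤ K * m Y := by
          gcongr
          rw [← (hpres.iterate n).measure_preimage (h.meas i).nullMeasurableSet]
          exact le_measure_sdiff
      _ = ∫⁻ _ in Y, K ∂m := (setLIntegral_const _ _).symm
      _ ≤ ∫⁻ x in Y, Hs T τ F n x ∂m := by
          refine setLIntegral_mono_ae' hYm ?_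
          have hx0 : ∀ᵐ x ∂m, x ∈ {x | ∀ k, ∃ i, T^[k] x ∈ α i} := h.null_X0 hpres
          filter_upwards [hx0] with x hx hxY
          obtain ⟨l, hl, hxl⟩ := exists_cyl (α i) n x hx hxY.1
          have e := Hs_wt (τ := τ) hFc (α i) l x hxl
          rw [hl] at e
          rw [e]
          by_contra hlt
          refine hxY.2 ?_
          simp only [goodAt, Set.mem_iUnion]
          exact ⟨l, ⟨hl, (not_le.1 hlt).le⟩, hxl⟩
      _ ≤ I n i := lintegral_mono_set Set.sdiff_subset
  have hfatou : ∑' i, liminf (fun n => I n i) atTop ≤ liminf (fun n => ∑' i, I n i) atTop := by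
    letI : MeasurableSpace ι := ⊤
    simp_rw [← lintegral_count]
    exact lintegral_liminf_le fun n => measurable_from_top
  have hfin : (1 - t)⁻¹ * M ≠ ⊤ := by
    refine ENNReal.mul_ne_top ?_ hcs
    rw [ENNReal.inv_ne_top]
    exact (tsub_pos_of_lt ht1).ne'
  refine ne_top_of_le_ne_top hfin ?_
  calc _ ≤ _ := ENNReal.tsum_le_tsum hliminf
    _ ≤ _ := hfatou
    _ ≤ liminf (fun _ : ℕ => (1 - t)⁻¹ * M) atTop :=
        liminf_le_liminf (Eventually.of_forall hIsum)
    _ = _ := liminf_const _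

end final

/-- Livšic regularity for positive recurrent Markov shifts: if `∑ m(a) Df(a) < ∞`
and `f = u - u ∘ T` a.e., then `Du(a) < ∞` for every `a ∈ α`; moreover if `T` is
transitive then `∑ m(a) Du(a) < ∞`. -/
theorem markov_shift_coboundary_regularity
    [MetricSpace X] [MeasurableSpace X] [BorelSpace X]
    [MetricSpace G] [AddCommGroup G] [MeasurableSpace G] [BorelSpace G]
    [LocallyCompactSpace G]
    (hinv : ∀ g x y : G, dist (g + x) (g + y) = dist x y)
    (m : Measure X) [IsProbabilityMeasure m]
    (T : X → X) (hpres : MeasurePreserving T m m)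
    (α : ι → Set X) (τ : ℝ) (hMS : MarkovShift m T α τ)
    (f u : X → G) (hu : Measurable u)
    (hf : (∑' i, m (α i) * essLip m f (α i)) ≠ ⊤)
    (hcob : ∀ᵐ x ∂m, f x = u x - u (T x)) :
    (∀ i, essLip m u (α i) ≠ ⊤) ∧
    ((∀ i j, ∃ n : ℕ, m (α j \ T^[n] '' α i) = 0) →
      (∑' i, m (α i) * essLip m u (α i)) ≠ ⊤) := by
  have hfi : ∀ i, essLip m f (α i) ≠ ⊤ := by
    intro i h0
    have := ENNReal.ne_top_of_tsum_ne_top hf i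
    rw [h0, ENNReal.mul_top (hMS.pos i).ne'] at this
    exact this rfl
  have hex : ∀ i, ∃ S : Set X, S ⊆ α i ∧ m (α i \ S) = 0 ∧
      ∀ x ∈ S, ∀ y ∈ S, edist (f x) (f y) ≤ (essLip m f (α i) + 1) * edist x y := by
    intro i
    have hlt : essLip m f (α i) < essLip m f (α i) + 1 :=
      ENNReal.lt_add_right (hfi i) one_ne_zero
    obtain ⟨C, ⟨S, hS1, hS2, hS3⟩, hC⟩ := sInf_lt_iff.1 hlt
    refine ⟨S, hS1, hS2, fun x hx y hy => (hS3 x hx y hy).trans ?_⟩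
    gcongr
  choose S hS1 hS2 hS3 using hex
  have hcount : Countable ι := hMS.countable
  have hΩ : m ({x | f x = u x - u (T x)} ∩ {x | ∀ i, x ∈ α i → x ∈ S i})ᶜ = 0 := by
    rw [Set.compl_inter]
    refine measure_union_null hcob ?_
    refine measure_mono_null ?_ (measure_iUnion_null hS2)
    intro x hx
    simp only [Set.mem_compl_iff, Set.mem_setOf_eq, not_forall] at hx
    obtain ⟨i, hi, hn⟩ := hx
    exact Set.mem_iUnion.2 ⟨i, hi, hn⟩
  have hsum : ∑' i, (essLip m f (α i) + 1) * m (α i) ≠ ⊤ := by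
    have e : ∀ i, (essLip m f (α i) + 1) * m (α i) = m (α i) * essLip m f (α i) + m (α i) := by
      intro i; ring
    simp_rw [e]
    rw [ENNReal.tsum_add]
    refine ENNReal.add_ne_top.2 ⟨hf, ?_⟩
    rw [← measure_iUnion hMS.disj hMS.meas]
    exact measure_ne_top _ _
  have main := hMS.final_bound hpres hinv hu
    (c := fun i => essLip m f (α i) + 1)
    (fun i => ENNReal.add_ne_top.2 ⟨hfi i, ENNReal.one_ne_top⟩) hsum hΩ
    (fun i x hx y hy => hS3 i x (hx.1.2 i hx.2) y (hy.1.2 i hy.2)) (fun x hx => hx.1)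
  refine ⟨fun i h0 => ?_, fun _ => main⟩
  have := ENNReal.ne_top_of_tsum_ne_top main i
  rw [h0, ENNReal.mul_top (hMS.pos i).ne'] at this
  exact this rfl
end
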